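/- Let φ ∈ K(z) have degree d ≥ 2. Then the minimal resultant iteration formula R_{[φⁿ]} = N_n · R_{[φ]} holds for every n ≥ 1 (with N_n = dⁿ(dⁿ−1)/(d(d−1))) if and only if the following holds: for every γ ∈ PGL₂(K) such that φ^γ has semistable reduction, one has (φ^γ)_v ∉ I(d) and (φ^γ)ⁿ has semistable reduction for all n ≥ 1. -/

import Mathlib

open MvPolynomial Matrix

noncomputable section

variable {R : Type*} [CommRing R]

def coeffVec (e : ℕ) (F : MvPolynomial (Fin 2) R) (i : Fin (e + 1)) : R :=
  MvPolynomial.coeff (Finsupp.single 0 (e - (i : ℕ)) + Finsupp.single 1 (i : ℕ)) F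

def sylv (e : ℕ) (a b : Fin (e + 1) → R) : Matrix (Fin (e + e)) (Fin (e + e)) R :=
  Matrix.of fun i j =>
    if h : (i : ℕ) < e then
      if hj : (i : ℕ) ≤ (j : ℕ) ∧ (j : ℕ) ≤ (i : ℕ) + e then
        a ⟨(j : ℕ) - (i : ℕ), by omega⟩ else 0
    else
      if hj : (i : ℕ) - e ≤ (j : ℕ) ∧ (j : ℕ) ≤ (i : ℕ) then
        b ⟨(j : ℕ) - ((i : ℕ) - e), by omega⟩ else 0

def bres (e : ℕ) (F G : MvPolynomial (Fin 2) R) : R :=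
  (sylv e (coeffVec e F) (coeffVec e G)).det

def comp2 (F f g : MvPolynomial (Fin 2) R) : MvPolynomial (Fin 2) R :=
  MvPolynomial.aeval ![f, g] F

def pairIter (F G : MvPolynomial (Fin 2) R) : ℕ → MvPolynomial (Fin 2) R × MvPolynomial (Fin 2) R
  | 0 => (X 0, X 1)
  | n + 1 => (comp2 F (pairIter F G n).1 (pairIter F G n).2,
              comp2 G (pairIter F G n).1 (pairIter F G n).2)

variable (K : Type) [NontriviallyNormedField K] [IsUltrametricDist K]

def ordv (x : K) : ℝ := -Real.log ‖x‖

def intRing : Subring K where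
  carrier := {x : K | ‖x‖ ≤ 1}
  one_mem' := by simp
  zero_mem' := by simp
  mul_mem' := by
    intro a b ha hb
    simp only [Set.mem_setOf_eq] at *
    calc ‖a * b‖ = ‖a‖ * ‖b‖ := norm_mul a b
    _ ≤ 1 * 1 := by gcongr
    _ = 1 := by ring
  add_mem' := by
    intro a b ha hb
    simp only [Set.mem_setOf_eq] at *
    exact (IsUltrametricDist.norm_add_le_max a b).trans (max_le ha hb)
  neg_mem' := by
    intro a ha
    simp only [Set.mem_setOf_eq, norm_neg] at *
    exact ha

def maxIdl : Ideal (intRing K) where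
  carrier := {x | ‖(x : K)‖ < 1}
  zero_mem' := by simp
  add_mem' := by
    intro a b ha hb
    simp only [Set.mem_setOf_eq] at *
    exact lt_of_le_of_lt (IsUltrametricDist.norm_add_le_max (a : K) b) (max_lt ha hb)
  smul_mem' := by
    intro c x hx
    simp only [Set.mem_setOf_eq] at *
    calc ‖((c • x : intRing K) : K)‖ = ‖(c : K)‖ * ‖(x : K)‖ := norm_mul _ _
    _ ≤ 1 * ‖(x : K)‖ := by gcongr; exact c.2
    _ < 1 := by simpa using hx

def kk := intRing K ⧸ maxIdl K

instance : CommRing (kk K) := Ideal.Quotient.commRing (maxIdl K)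

def redCoeff (x : K) : kk K :=
  if h : ‖x‖ ≤ 1 then Ideal.Quotient.mk (maxIdl K) ⟨x, h⟩ else 0

def redPoly (F : MvPolynomial (Fin 2) K) : MvPolynomial (Fin 2) (kk K) :=
  ∑ m ∈ F.support, MvPolynomial.monomial m (redCoeff K (F.coeff m))

/-- A pair of binary forms is a (homogeneous) lift of a degree-`d` rational map if both entries
are homogeneous of degree `d` and they are coprime. -/
def LiftPair (d : ℕ) (F G : MvPolynomial (Fin 2) K) : Prop :=
  F.IsHomogeneous d ∧ G.IsHomogeneous d ∧ IsRelPrime F G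

/-- A pair of binary forms is normalized if all coefficients lie in `O`
and some coefficient has absolute value `1`. -/
def Normalized (F G : MvPolynomial (Fin 2) K) : Prop :=
  (∀ m, ‖F.coeff m‖ ≤ 1) ∧ (∀ m, ‖G.coeff m‖ ≤ 1) ∧
    (∃ m, ‖F.coeff m‖ = 1 ∨ ‖G.coeff m‖ = 1)

/-- The maximum of the absolute values of the coefficients of a pair of degree-`e` binary forms. -/
def maxNorm (e : ℕ) (F G : MvPolynomial (Fin 2) K) : ℝ :=
  Finset.univ.sup' Finset.univ_nonempty
    (fun i : Fin (e + 1) => max ‖coeffVec e F i‖ ‖coeffVec e G i‖)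

/-- `Rpair e F G` is the quantity `R_φ = ord(Res(F₀,G₀))` where `(F₀,G₀)` is the normalized
rescaling of the pair `(F,G)` of degree-`e` binary forms; equivalently it is
`ord(Res(F,G)) - 2·e·(minimal ord of a coefficient of F, G)`. -/
def Rpair (e : ℕ) (F G : MvPolynomial (Fin 2) K) : ℝ :=
  ordv K (bres e F G) + 2 * e * Real.log (maxNorm K e F G)

/-- Linear substitution of a `2×2` matrix into a binary form. -/
def mobius (M : Matrix (Fin 2) (Fin 2) K) (F : MvPolynomial (Fin 2) K) :
    MvPolynomial (Fin 2) K :=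
  MvPolynomial.aeval
    ![C (M 0 0) * X 0 + C (M 0 1) * X 1, C (M 1 0) * X 0 + C (M 1 1) * X 1] F

/-- The conjugate pair `γ⁻¹ ∘ (F,G) ∘ γ`, a homogeneous lift of `φ^γ = γ⁻¹ ∘ φ ∘ γ`. -/
def conjPair (M : GL (Fin 2) K) (F G : MvPolynomial (Fin 2) K) :
    MvPolynomial (Fin 2) K × MvPolynomial (Fin 2) K :=
  (C ((M⁻¹ : GL (Fin 2) K) 0 0) * mobius K M F + C ((M⁻¹ : GL (Fin 2) K) 0 1) * mobius K M G,
   C ((M⁻¹ : GL (Fin 2) K) 1 0) * mobius K M F + C ((M⁻¹ : GL (Fin 2) K) 1 1) * mobius K M G)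

/-- The minimal resultant `R_{[φ]} = inf_γ R_{φ^γ}` of (the map lifted by) a degree-`e` pair. -/
def Rmin (e : ℕ) (F G : MvPolynomial (Fin 2) K) : ℝ :=
  ⨅ M : GL (Fin 2) K, Rpair K e (conjPair K M F G).1 (conjPair K M F G).2

/-- `Ilocus d F G` says the reduction of the normalized pair `(F,G)` lies in the indeterminacy
locus `I(d)`: the reduced pair is proportional, i.e. `(F̃, G̃) = (a·C, b·C)` with `[a:b] ∈ P¹(k)`
(so that the residue map is the constant `[a:b]`), and the constant value `[a:b]`
is a root of the common factor `C` (which is the gcd `Ã` of `F̃` and `G̃`). -/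
def Ilocus (d : ℕ) (F G : MvPolynomial (Fin 2) K) : Prop :=
  ∃ (a b : kk K) (Cf : MvPolynomial (Fin 2) (kk K)),
    ¬(a = 0 ∧ b = 0) ∧ Cf.IsHomogeneous d ∧
    redPoly K F = MvPolynomial.C a * Cf ∧ redPoly K G = MvPolynomial.C b * Cf ∧
    MvPolynomial.eval ![a, b] Cf = 0

/-- `Semistable d F G` says the reduction of the normalized pair `(F,G)` is GIT-semistable
(Silverman's numerical criterion): writing `F̃ = Ã·F̃₀`, `G̃ = Ã·G̃₀` with `F̃₀, G̃₀` coprime,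
every root `h = [a:b]` of `Ã` has multiplicity `r ≤ d/2` (`d` even), resp. `r ≤ (d+1)/2`
(`d` odd), and when the bound is attained additionally `φ̃(h) ≠ h`. -/
def Semistable (d : ℕ) (F G : MvPolynomial (Fin 2) K) : Prop :=
  ∃ (A F0 G0 : MvPolynomial (Fin 2) (kk K)) (e : ℕ),
    e ≤ d ∧ A.IsHomogeneous (d - e) ∧ F0.IsHomogeneous e ∧ G0.IsHomogeneous e ∧
    redPoly K F = A * F0 ∧ redPoly K G = A * G0 ∧ IsRelPrime F0 G0 ∧
    ∀ (a b : kk K), ¬(a = 0 ∧ b = 0) → ∀ r : ℕ,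
      (MvPolynomial.C b * X 0 - MvPolynomial.C a * X 1) ^ r ∣ A →
        2 * r ≤ d + 1 ∧
          (d ≤ 2 * r →
            b * MvPolynomial.eval ![a, b] F0 ≠ a * MvPolynomial.eval ![a, b] G0)

/-- The rational map lifted by the (not necessarily normalized) pair `(F,G)` has semistable
reduction: some normalized rescaling is `Semistable`. -/
def HasSemistableRed (d : ℕ) (F G : MvPolynomial (Fin 2) K) : Prop :=
  ∃ c : Kˣ, Normalized K ((c : K) • F) ((c : K) • G) ∧
    Semistable K d ((c : K) • F) ((c : K) • G)

/-- The reduction of (a normalized rescaling of) the pair `(F,G)` lies outside `I(d)`. -/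
def RedOutsideI (d : ℕ) (F G : MvPolynomial (Fin 2) K) : Prop :=
  ∃ c : Kˣ, Normalized K ((c : K) • F) ((c : K) • G) ∧
    ¬ Ilocus K d ((c : K) • F) ((c : K) • G)

/-- The `m`-th term (`m ≥ 1`) of Tate's series `x(w)`. -/
def tateTerm (q w : K) (m : ℕ) : K :=
  q ^ m * w / (1 - q ^ m * w) ^ 2 + q ^ m * w⁻¹ / (1 - q ^ m * w⁻¹) ^ 2
    - 2 * (q ^ m / (1 - q ^ m) ^ 2)

/-- Tate's series `x(w)` for the Tate curve with parameter `q`. -/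
def xTate (q w : K) : K :=
  w / (1 - w) ^ 2 + ∑' m : ℕ, tateTerm K q w (m + 1)

section BinaryForms

variable {S : Type*} [CommRing S]

lemma MvPolynomial.IsHomogeneous.exponents_add {H : MvPolynomial (Fin 2) S} {n : ℕ}
    (hH : H.IsHomogeneous n) {m : Fin 2 →₀ ℕ} (hm : H.coeff m ≠ 0) : m 0 + m 1 = n := by
  have h := hH hm
  change Finsupp.weight (fun _ => 1) m = n at h
  rw [← Finsupp.degree_eq_weight_one, Finsupp.degree_eq_sum] at h
  simpa using h

lemma finsupp_fin_two_eq (m : Fin 2 →₀ ℕ) :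
    m = Finsupp.single 0 (m 0) + Finsupp.single 1 (m 1) := by
  ext i; fin_cases i <;> simp

lemma MvPolynomial.IsHomogeneous.aeval_mul_mul {A : Type*} [CommRing A] [Algebra S A]
    {H : MvPolynomial (Fin 2) S} {n : ℕ} (hH : H.IsHomogeneous n) (t x y : A) :
    MvPolynomial.aeval ![t * x, t * y] H = t ^ n * MvPolynomial.aeval ![x, y] H := by
  rw [aeval_def, aeval_def, eval₂_eq', eval₂_eq', Finset.mul_sum]
  refine Finset.sum_congr rfl fun m hm => ?_
  have h := hH.exponents_add (mem_support_iff.1 hm)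
  simp only [Fin.prod_univ_two, Matrix.cons_val_zero, Matrix.cons_val_one, mul_pow]
  rw [← h, pow_add]; ring

/-- Linear substitution of a `2×2` matrix into a binary form, over any commutative ring. -/
def linSubst (M : Matrix (Fin 2) (Fin 2) S) :
    MvPolynomial (Fin 2) S →ₐ[S] MvPolynomial (Fin 2) S :=
  aeval ![C (M 0 0) * X 0 + C (M 0 1) * X 1, C (M 1 0) * X 0 + C (M 1 1) * X 1]

@[simp] lemma linSubst_X_zero (M : Matrix (Fin 2) (Fin 2) S) :
    linSubst M (X 0) = C (M 0 0) * X 0 + C (M 0 1) * X 1 := by simp [linSubst]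

@[simp] lemma linSubst_X_one (M : Matrix (Fin 2) (Fin 2) S) :
    linSubst M (X 1) = C (M 1 0) * X 0 + C (M 1 1) * X 1 := by simp [linSubst]

@[simp] lemma linSubst_C (M : Matrix (Fin 2) (Fin 2) S) (c : S) : linSubst M (C c) = C c := by
  simp [linSubst]

lemma linSubst_mul (M N : Matrix (Fin 2) (Fin 2) S) (H : MvPolynomial (Fin 2) S) :
    linSubst (M * N) H = linSubst N (linSubst M H) := by
  rw [← AlgHom.comp_apply]
  congr 1
  ext i : 1
  fin_cases i <;>
  · simp [Matrix.mul_apply, Fin.sum_univ_two]; ring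

lemma linSubst_one (H : MvPolynomial (Fin 2) S) : linSubst 1 H = H := by
  conv_rhs => rw [← AlgHom.id_apply (R := S) H]
  congr 1
  ext i : 1
  fin_cases i <;> simp

lemma map_linSubst {T : Type*} [CommRing T] (f : S →+* T) (M : Matrix (Fin 2) (Fin 2) S)
    (H : MvPolynomial (Fin 2) S) :
    map f (linSubst M H) = linSubst (M.map f) (map f H) := by
  induction H using MvPolynomial.induction_on with
  | C c => simp
  | add p q hp hq => simp only [map_add, hp, hq]
  | mul_X p i hp =>
    simp only [map_mul, hp, map_X]
    fin_cases i <;> simp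

lemma linSubst_isHomogeneous (M : Matrix (Fin 2) (Fin 2) S) {H : MvPolynomial (Fin 2) S} {n : ℕ}
    (hH : H.IsHomogeneous n) : (linSubst M H).IsHomogeneous n := by
  have := hH.aeval (n := 1) (τ := Fin 2)
    ![C (M 0 0) * X 0 + C (M 0 1) * X 1, C (M 1 0) * X 0 + C (M 1 1) * X 1] (by
    intro i
    fin_cases i <;> exact (isHomogeneous_C_mul_X _ _).add (isHomogeneous_C_mul_X _ _))
  rw [one_mul] at this
  exact this

lemma eval_linSubst (M : Matrix (Fin 2) (Fin 2) S) (H : MvPolynomial (Fin 2) S) (a b : S) :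
    eval ![a, b] (linSubst M H) = eval ![M 0 0 * a + M 0 1 * b, M 1 0 * a + M 1 1 * b] H := by
  induction H using MvPolynomial.induction_on with
  | C c => simp
  | add p q hp hq => simp only [map_add, hp, hq]
  | mul_X p i hp =>
    simp only [map_mul, hp]
    fin_cases i <;> simp

lemma comp2_linSubst_left (M : Matrix (Fin 2) (Fin 2) S) (H f g : MvPolynomial (Fin 2) S) :
    comp2 (linSubst M H) f g =
      comp2 H (C (M 0 0) * f + C (M 0 1) * g) (C (M 1 0) * f + C (M 1 1) * g) := by
  unfold comp2
  induction H using MvPolynomial.induction_on with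
  | C c => simp
  | add p q hp hq => simp only [map_add, hp, hq]
  | mul_X p i hp =>
    simp only [map_mul, hp]
    fin_cases i <;> simp [algebraMap_eq]

lemma comp2_linSubst_right (M : Matrix (Fin 2) (Fin 2) S) (H f g : MvPolynomial (Fin 2) S) :
    comp2 H (linSubst M f) (linSubst M g) = linSubst M (comp2 H f g) := by
  unfold comp2
  induction H using MvPolynomial.induction_on with
  | C c => simp
  | add p q hp hq => simp only [map_add, hp, hq]
  | mul_X p i hp =>
    simp only [map_mul, hp]
    fin_cases i <;> simp

lemma map_comp2 {T : Type*} [CommRing T] (φ : S →+* T) (H f g : MvPolynomial (Fin 2) S) :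
    map φ (comp2 H f g) = comp2 (map φ H) (map φ f) (map φ g) := by
  unfold comp2
  induction H using MvPolynomial.induction_on with
  | C c => simp
  | add p q hp hq => simp only [map_add, hp, hq]
  | mul_X p i hp =>
    simp only [map_mul, hp, map_X]
    fin_cases i <;> simp

lemma eval_comp2 (H f g : MvPolynomial (Fin 2) S) (a b : S) :
    eval ![a, b] (comp2 H f g) = eval ![eval ![a, b] f, eval ![a, b] g] H := by
  unfold comp2
  induction H using MvPolynomial.induction_on with
  | C c => simp
  | add p q hp hq => simp only [map_add, hp, hq]
  | mul_X p i hp =>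
    simp only [map_mul, hp]
    fin_cases i <;> simp

lemma comp2_isHomogeneous {H f g : MvPolynomial (Fin 2) S} {m n : ℕ} (hH : H.IsHomogeneous m)
    (hf : f.IsHomogeneous n) (hg : g.IsHomogeneous n) : (comp2 H f g).IsHomogeneous (n * m) :=
  hH.aeval _ (by intro i; fin_cases i <;> simpa)

lemma comp2_mul_mul {H : MvPolynomial (Fin 2) S} {n : ℕ} (hH : H.IsHomogeneous n)
    (t f g : MvPolynomial (Fin 2) S) : comp2 H (t * f) (t * g) = t ^ n * comp2 H f g :=
  hH.aeval_mul_mul t f g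

/-- Conjugation of a pair of binary forms, over any commutative ring. -/
def conjForms (M : GL (Fin 2) S) (F G : MvPolynomial (Fin 2) S) :
    MvPolynomial (Fin 2) S × MvPolynomial (Fin 2) S :=
  (C (M⁻¹.val 0 0) * linSubst M.val F + C (M⁻¹.val 0 1) * linSubst M.val G,
   C (M⁻¹.val 1 0) * linSubst M.val F + C (M⁻¹.val 1 1) * linSubst M.val G)

lemma conjForms_mul (M N : GL (Fin 2) S) (F G : MvPolynomial (Fin 2) S) :
    conjForms (M * N) F G = conjForms N (conjForms M F G).1 (conjForms M F G).2 := by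
  ext1 <;>
  · simp [conjForms, linSubst_mul, _root_.mul_inv_rev, Matrix.mul_apply, Fin.sum_univ_two,
      -Matrix.coe_units_inv]
    ring

lemma conjForms_one (F G : MvPolynomial (Fin 2) S) : conjForms 1 F G = (F, G) := by
  simp [conjForms, linSubst_one]

lemma map_conjForms {T : Type*} [CommRing T] (f : S →+* T) (M : GL (Fin 2) S)
    (F G : MvPolynomial (Fin 2) S) :
    conjForms (Matrix.GeneralLinearGroup.map f M) (map f F) (map f G) =
      (map f (conjForms M F G).1, map f (conjForms M F G).2) := by
  have h : (Matrix.GeneralLinearGroup.map f M).val = M.val.map f := rfl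
  have h' : (Matrix.GeneralLinearGroup.map f M)⁻¹.val = M⁻¹.val.map f := rfl
  simp [conjForms, map_linSubst, h, h', -Matrix.coe_units_inv]

lemma conjForms_isHomogeneous (M : GL (Fin 2) S) {F G : MvPolynomial (Fin 2) S} {n : ℕ}
    (hF : F.IsHomogeneous n) (hG : G.IsHomogeneous n) :
    (conjForms M F G).1.IsHomogeneous n ∧ (conjForms M F G).2.IsHomogeneous n :=
  ⟨((linSubst_isHomogeneous _ hF).C_mul _).add ((linSubst_isHomogeneous _ hG).C_mul _),
    ((linSubst_isHomogeneous _ hF).C_mul _).add ((linSubst_isHomogeneous _ hG).C_mul _)⟩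

lemma GL_two_mul_inv (M : GL (Fin 2) S) :
    M.val 0 0 * M⁻¹.val 0 0 + M.val 0 1 * M⁻¹.val 1 0 = 1 ∧
    M.val 0 0 * M⁻¹.val 0 1 + M.val 0 1 * M⁻¹.val 1 1 = 0 ∧
    M.val 1 0 * M⁻¹.val 0 0 + M.val 1 1 * M⁻¹.val 1 0 = 0 ∧
    M.val 1 0 * M⁻¹.val 0 1 + M.val 1 1 * M⁻¹.val 1 1 = 1 := by
  have h : M.val * M⁻¹.val = 1 := M.mul_inv
  have e := fun i j => congrFun (congrFun h i) j
  simp only [Matrix.mul_apply, Fin.sum_univ_two] at e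
  refine ⟨by simpa using e 0 0, by simpa using e 0 1, by simpa using e 1 0, by simpa using e 1 1⟩

lemma mul_conjForms (M : GL (Fin 2) S) (F G : MvPolynomial (Fin 2) S) :
    C (M.val 0 0) * (conjForms M F G).1 + C (M.val 0 1) * (conjForms M F G).2 =
      linSubst M.val F ∧
    C (M.val 1 0) * (conjForms M F G).1 + C (M.val 1 1) * (conjForms M F G).2 =
      linSubst M.val G := by
  obtain ⟨h1, h2, h3, h4⟩ := GL_two_mul_inv M
  have c1 := congrArg (C : S →+* MvPolynomial (Fin 2) S) h1
  have c2 := congrArg (C : S →+* MvPolynomial (Fin 2) S) h2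
  have c3 := congrArg (C : S →+* MvPolynomial (Fin 2) S) h3
  have c4 := congrArg (C : S →+* MvPolynomial (Fin 2) S) h4
  simp only [map_add, map_mul, map_one, map_zero] at c1 c2 c3 c4
  simp only [conjForms]
  constructor
  · linear_combination (linSubst M.val F) * c1 + (linSubst M.val G) * c2
  · linear_combination (linSubst M.val F) * c3 + (linSubst M.val G) * c4

lemma pairIter_conjForms (M : GL (Fin 2) S) (F G : MvPolynomial (Fin 2) S) (n : ℕ) :
    pairIter (conjForms M F G).1 (conjForms M F G).2 n =
      conjForms M (pairIter F G n).1 (pairIter F G n).2 := by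
  induction n with
  | zero =>
    have h := GL_two_mul_inv M⁻¹
    rw [inv_inv] at h
    obtain ⟨h1, h2, h3, h4⟩ := h
    have c1 := congrArg (C : S →+* MvPolynomial (Fin 2) S) h1
    have c2 := congrArg (C : S →+* MvPolynomial (Fin 2) S) h2
    have c3 := congrArg (C : S →+* MvPolynomial (Fin 2) S) h3
    have c4 := congrArg (C : S →+* MvPolynomial (Fin 2) S) h4
    simp only [map_add, map_mul, map_one, map_zero] at c1 c2 c3 c4
    simp only [pairIter]
    ext1
    · simp only [conjForms, linSubst_X_zero, linSubst_X_one]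
      linear_combination -X 0 * c1 - X 1 * c2
    · simp only [conjForms, linSubst_X_zero, linSubst_X_one]
      linear_combination -X 0 * c3 - X 1 * c4
  | succ n ih =>
    simp only [pairIter, ih]
    obtain ⟨e1, e2⟩ := mul_conjForms M (pairIter F G n).1 (pairIter F G n).2
    have key : ∀ H : MvPolynomial (Fin 2) S, comp2 (linSubst M.val H)
        (conjForms M (pairIter F G n).1 (pairIter F G n).2).1
        (conjForms M (pairIter F G n).1 (pairIter F G n).2).2 =
        linSubst M.val (comp2 H (pairIter F G n).1 (pairIter F G n).2) := by
      intro H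
      rw [comp2_linSubst_left, e1, e2, comp2_linSubst_right]
    have lin : ∀ (a b : S) (P Q f g : MvPolynomial (Fin 2) S),
        comp2 (C a * P + C b * Q) f g = C a * comp2 P f g + C b * comp2 Q f g := by
      intro a b P Q f g; simp [comp2, algebraMap_eq]
    ext1
    · conv_lhs => rw [conjForms]
      simp only [lin, key]; rfl
    · conv_lhs => rw [conjForms]
      simp only [lin, key]; rfl

lemma pairIter_isHomogeneous {F G : MvPolynomial (Fin 2) S} {d : ℕ}
    (hF : F.IsHomogeneous d) (hG : G.IsHomogeneous d) (n : ℕ) :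
    (pairIter F G n).1.IsHomogeneous (d ^ n) ∧ (pairIter F G n).2.IsHomogeneous (d ^ n) := by
  induction n with
  | zero => exact ⟨isHomogeneous_X _ _, isHomogeneous_X _ _⟩
  | succ n ih =>
    exact ⟨pow_succ d n ▸ comp2_isHomogeneous hF ih.1 ih.2,
      pow_succ d n ▸ comp2_isHomogeneous hG ih.1 ih.2⟩

lemma map_pairIter {T : Type*} [CommRing T] (φ : S →+* T) (F G : MvPolynomial (Fin 2) S) (n : ℕ) :
    pairIter (map φ F) (map φ G) n =
      (map φ (pairIter F G n).1, map φ (pairIter F G n).2) := by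
  induction n with
  | zero => simp [pairIter]
  | succ n ih => simp only [pairIter, ih, map_comp2]

/-- The pair `(F, G)` has no nontrivial common zero. -/
def NoCommonZero (F G : MvPolynomial (Fin 2) S) : Prop :=
  ∀ a b : S, eval ![a, b] F = 0 → eval ![a, b] G = 0 → a = 0 ∧ b = 0

lemma NoCommonZero.conjForms {F G : MvPolynomial (Fin 2) S} (h : NoCommonZero F G)
    (M : GL (Fin 2) S) : NoCommonZero (conjForms M F G).1 (conjForms M F G).2 := by
  intro a b h1 h2
  obtain ⟨e1, e2⟩ := mul_conjForms M F G
  have f1 := congrArg (eval ![a, b]) e1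
  have f2 := congrArg (eval ![a, b]) e2
  simp only [map_add, map_mul, h1, h2, mul_zero, add_zero, eval_linSubst] at f1 f2
  obtain ⟨g1, g2⟩ := h _ _ f1.symm f2.symm
  have hi := GL_two_mul_inv M⁻¹
  rw [inv_inv] at hi
  obtain ⟨h1, h2, h3, h4⟩ := hi
  constructor
  · linear_combination (M⁻¹.val 0 0) * g1 + (M⁻¹.val 0 1) * g2 - a * h1 - b * h2
  · linear_combination (M⁻¹.val 1 0) * g1 + (M⁻¹.val 1 1) * g2 - a * h3 - b * h4

lemma NoCommonZero.pairIter {F G : MvPolynomial (Fin 2) S} (h : NoCommonZero F G) (n : ℕ) :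
    NoCommonZero (pairIter F G n).1 (pairIter F G n).2 := by
  induction n with
  | zero => intro a b h1 h2; exact ⟨by simpa [_root_.pairIter] using h1, by simpa [_root_.pairIter] using h2⟩
  | succ n ih =>
    intro a b h1 h2
    simp only [_root_.pairIter, eval_comp2] at h1 h2
    obtain ⟨h3, h4⟩ := h _ _ h1 h2
    exact ih _ _ h3 h4

/-- The linear form vanishing at `(a, b)`. -/
def linForm (a b : S) : MvPolynomial (Fin 2) S := C b * X 0 - C a * X 1

lemma linForm_isHomogeneous (a b : S) : (linForm a b).IsHomogeneous 1 :=
  (isHomogeneous_C_mul_X _ _).sub (isHomogeneous_C_mul_X _ _)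

lemma eval_linForm (a b x y : S) : eval ![x, y] (linForm a b) = b * x - a * y := by
  simp [linForm]

end BinaryForms

section Field

variable {k : Type*} [Field k]

lemma linForm_ne_zero {a b : k} (h : ¬(a = 0 ∧ b = 0)) : linForm a b ≠ 0 := by
  intro h0
  have h1 := congrArg (eval ![1, 0]) h0
  have h2 := congrArg (eval ![0, 1]) h0
  simp only [eval_linForm, map_zero] at h1 h2
  exact h ⟨by simpa using h2, by simpa using h1⟩

lemma linForm_irreducible {a b : k} (h : ¬(a = 0 ∧ b = 0)) : Irreducible (linForm a b) := by
  apply irreducible_of_totalDegree_eq_one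
    ((linForm_isHomogeneous a b).totalDegree (linForm_ne_zero h))
  intro x hx
  have h0 := hx (Finsupp.single 0 1)
  have h1 := hx (Finsupp.single 1 1)
  rw [isUnit_iff_ne_zero]
  rintro rfl
  simp only [linForm, zero_dvd_iff, coeff_sub, coeff_C_mul, coeff_X, Finsupp.single_left_inj one_ne_zero] at h0 h1
  simp at h0 h1
  exact h ⟨h1, h0⟩

lemma linForm_dvd_iff {a b : k} (h : ¬(a = 0 ∧ b = 0)) {H : MvPolynomial (Fin 2) k} {n : ℕ}
    (hH : H.IsHomogeneous n) : linForm a b ∣ H ↔ eval ![a, b] H = 0 := by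
  constructor
  · rintro ⟨q, rfl⟩
    rw [map_mul, eval_linForm]; ring
  intro h0
  let q := Ideal.Quotient.mkₐ k (Ideal.span {linForm a b})
  have hrel : q (C b * X 0) = q (C a * X 1) := by
    rw [← sub_eq_zero, ← map_sub]
    exact Ideal.Quotient.eq_zero_iff_mem.2 (Ideal.mem_span_singleton_self _)
  have key : ∀ c : k, q (C c) ^ n * q H = aeval ![q (C c * X 0), q (C c * X 1)] H := by
    intro c
    rw [map_mul, map_mul, hH.aeval_mul_mul]
    congr 1
    conv_lhs => rw [← AlgHom.comp_id q, ← aeval_X_left, AlgHom.comp_apply]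
    rw [← AlgHom.comp_apply, comp_aeval]
    congr 2
    ext i; fin_cases i <;> rfl
  have hval : ∀ z, aeval ![z * q (C a), z * q (C b)] H = 0 := by
    intro z
    rw [hH.aeval_mul_mul]
    have : aeval ![q (C a), q (C b)] H = q (C (eval ![a, b] H)) := by
      rw [← AlgHom.coe_toRingHom, ← RingHom.comp_apply, ← AlgHom.coe_toRingHom,
        ← RingHom.comp_apply]
      conv_rhs => rw [← RingHom.comp_apply]
      congr 1
      ext i
      · simp
      · fin_cases i <;> simp
    rw [this, h0]; simp
  have hunit : ∃ c : k, c ≠ 0 ∧ aeval ![q (C c * X 0), q (C c * X 1)] H = 0 := by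
    by_cases hb : b = 0
    · have ha : a ≠ 0 := fun ha => h ⟨ha, hb⟩
      refine ⟨a, ha, ?_⟩
      rw [← hrel]
      convert hval (q (X 0)) using 3
      simp [mul_comm]
    · refine ⟨b, hb, ?_⟩
      rw [hrel]
      convert hval (q (X 1)) using 3
      simp [mul_comm]
  obtain ⟨c, hc, hz⟩ := hunit
  rw [← key c] at hz
  have hu : IsUnit (q (C c) ^ n) := ((hc.isUnit.map C).map q).pow n
  have := hu.mul_right_eq_zero.1 hz
  exact Ideal.mem_span_singleton.1 (Ideal.Quotient.eq_zero_iff_mem.1 this)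

lemma exists_isHomogeneous_of_linForm_dvd {a b : k} {H : MvPolynomial (Fin 2) k} {n : ℕ}
    (hH : H.IsHomogeneous (n + 1)) (h : linForm a b ∣ H) :
    ∃ Q : MvPolynomial (Fin 2) k, Q.IsHomogeneous n ∧ H = linForm a b * Q := by
  obtain ⟨q, rfl⟩ := h
  refine ⟨homogeneousComponent n q, homogeneousComponent_isHomogeneous n q, ?_⟩
  let : GradedAlgebra (homogeneousSubmodule (Fin 2) k) := gradedAlgebra
  have h1 := DirectSum.coe_decompose_mul_add_of_left_mem
    (homogeneousSubmodule (Fin 2) k) (i := 1) (j := n) (b := q) (linForm_isHomogeneous a b)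
  have h2 : ∀ (i : ℕ) (p : MvPolynomial (Fin 2) k),
      (DirectSum.decompose (homogeneousSubmodule (Fin 2) k) p i : MvPolynomial (Fin 2) k) =
        homogeneousComponent i p :=
    fun i p => decomposition.decompose'_apply p i
  rw [h2, h2, add_comm, homogeneousComponent_of_mem hH, if_pos rfl] at h1
  exact h1

lemma IsRelPrime.noCommonZero {F G : MvPolynomial (Fin 2) k} {m n : ℕ}
    (hF : F.IsHomogeneous m) (hG : G.IsHomogeneous n) (h : IsRelPrime F G) :
    NoCommonZero F G := by
  intro a b h1 h2
  by_contra hab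
  exact (linForm_irreducible hab).not_isUnit
    (h ((linForm_dvd_iff hab hF).2 h1) ((linForm_dvd_iff hab hG).2 h2))

variable [IsAlgClosed k]

lemma exists_zero_of_isHomogeneous_succ {H : MvPolynomial (Fin 2) k} {n : ℕ}
    (hH : H.IsHomogeneous (n + 1)) : ∃ a b : k, ¬(a = 0 ∧ b = 0) ∧ eval ![a, b] H = 0 := by
  by_cases h0 : eval ![0, 1] H = 0
  · exact ⟨0, 1, by simp, h0⟩
  let p : Polynomial k := aeval ![Polynomial.C 1, Polynomial.X] H
  have hp : ∀ t, p.eval t = eval ![1, t] H := by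
    intro t
    simp only [p]
    rw [← Polynomial.coe_evalRingHom, ← AlgHom.coe_toRingHom, ← RingHom.comp_apply]
    congr 1
    ext i
    · simp
    · fin_cases i <;> simp
  by_cases hdeg : p.degree = 0
  · refine ⟨0, 1, by simp, ?_⟩
    have hc := Polynomial.eq_C_of_degree_eq_zero hdeg
    have h1 : p.coeff (n + 1) = 0 := by
      rw [hc, Polynomial.coeff_C]; simp
    have h2 : p.coeff (n + 1) = coeff (Finsupp.single 1 (n + 1)) H := by
      simp only [p]
      conv_lhs => rw [aeval_def, eval₂_eq']
      rw [Polynomial.finsetSum_coeff]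
      simp only [Fin.prod_univ_two, Matrix.cons_val_zero, Matrix.cons_val_one, map_one, one_pow,
        one_mul, ← Polynomial.C_eq_algebraMap, Polynomial.coeff_C_mul, Polynomial.coeff_X_pow]
      rw [Finset.sum_eq_single (Finsupp.single 1 (n + 1))]
      · simp
      · intro m hm hne
        rw [if_neg, mul_zero]
        intro he
        have hs := hH.exponents_add (mem_support_iff.1 hm)
        apply hne
        rw [finsupp_fin_two_eq m, ← he]
        have : m 0 = 0 := by omega
        simp [this]
      · intro hm
        rw [notMem_support_iff.1 hm, zero_mul]
    rw [h1] at h2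
    rw [eval_eq']
    refine Finset.sum_eq_zero fun m hm => ?_
    have hs := hH.exponents_add (mem_support_iff.1 hm)
    by_cases hm0 : m 0 = 0
    · exfalso
      apply mem_support_iff.1 hm
      rw [finsupp_fin_two_eq m, hm0]
      rw [hm0, zero_add] at hs
      rw [hs, Finsupp.single_zero, zero_add, ← h2]
    · simp [hm0]
  · obtain ⟨t, ht⟩ := IsAlgClosed.exists_root p hdeg
    exact ⟨1, t, by simp, by rw [← hp]; exact ht⟩

/-- Over an algebraically closed field every binary form is a product of linear forms. -/
lemma binaryForm_induction {P : ℕ → MvPolynomial (Fin 2) k → Prop} (hC : ∀ c, P 0 (C c))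
    (hmul : ∀ (a b : k) (n : ℕ) (H : MvPolynomial (Fin 2) k), ¬(a = 0 ∧ b = 0) →
      H.IsHomogeneous n → P n H → P (n + 1) (linForm a b * H))
    {n : ℕ} {H : MvPolynomial (Fin 2) k} (hH : H.IsHomogeneous n) : P n H := by
  induction n generalizing H with
  | zero =>
    rw [totalDegree_eq_zero_iff_eq_C.1 ((totalDegree_zero_iff_isHomogeneous _).2 hH)]
    exact hC _
  | succ n ih =>
    obtain ⟨a, b, hab, h0⟩ := exists_zero_of_isHomogeneous_succ hH
    obtain ⟨Q, hQ, rfl⟩ := exists_isHomogeneous_of_linForm_dvd hH ((linForm_dvd_iff hab hH).2 h0)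
    exact hmul a b n Q hab hQ (ih hQ)

lemma exists_linForm_of_prime_dvd {q : MvPolynomial (Fin 2) k} (hq : Prime q) {n : ℕ}
    {H : MvPolynomial (Fin 2) k} (hH : H.IsHomogeneous n) :
    H ≠ 0 → q ∣ H → ∃ a b : k, ¬(a = 0 ∧ b = 0) ∧ Associated q (linForm a b) := by
  refine binaryForm_induction (P := fun n H => H ≠ 0 → q ∣ H →
    ∃ a b : k, ¬(a = 0 ∧ b = 0) ∧ Associated q (linForm a b)) ?_ ?_ hH
  · intro c hc hd
    refine absurd (isUnit_of_dvd_unit hd ?_) hq.not_isUnit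
    exact (isUnit_iff_ne_zero.2 fun h => hc (by rw [h, map_zero])).map C
  · intro a b n H hab _ ih hne hd
    rcases hq.dvd_or_dvd hd with h | h
    · exact ⟨a, b, hab, hq.irreducible.associated_of_dvd (linForm_irreducible hab) h⟩
    · exact ih (fun h0 => hne (by rw [h0, mul_zero])) h

lemma NoCommonZero.isRelPrime {F G : MvPolynomial (Fin 2) k} {m n : ℕ}
    (hF : F.IsHomogeneous m) (hG : G.IsHomogeneous n) (h : NoCommonZero F G) :
    IsRelPrime F G := by
  intro q hqF hqG
  by_contra hu
  have hne : F ≠ 0 ∨ G ≠ 0 := by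
    by_contra! h0
    have := h 1 1 (by simp [h0.1]) (by simp [h0.2])
    exact one_ne_zero this.1
  have hq0 : q ≠ 0 := by
    rintro rfl
    rcases hne with h0 | h0
    · exact h0 (zero_dvd_iff.1 hqF)
    · exact h0 (zero_dvd_iff.1 hqG)
  obtain ⟨p, hp, hpq⟩ := WfDvdMonoid.exists_irreducible_factor hu hq0
  have : ∃ a b : k, ¬(a = 0 ∧ b = 0) ∧ Associated p (linForm a b) := by
    rcases hne with h0 | h0
    · exact exists_linForm_of_prime_dvd hp.prime hF h0 (hpq.trans hqF)
    · exact exists_linForm_of_prime_dvd hp.prime hG h0 (hpq.trans hqG)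
  obtain ⟨a, b, hab, has⟩ := this
  exact hab (h a b ((linForm_dvd_iff hab hF).1 (has.dvd_iff_dvd_left.1 (hpq.trans hqF)))
    ((linForm_dvd_iff hab hG).1 (has.dvd_iff_dvd_left.1 (hpq.trans hqG))))

end Field

section Resultants

variable {k : Type*} [Field k]

/-- Dehomogenization of a binary form at `X 0 = 1`. -/
def dehom : MvPolynomial (Fin 2) k →ₐ[k] Polynomial k := aeval ![1, Polynomial.X]

lemma coeff_dehom {F : MvPolynomial (Fin 2) k} {e : ℕ} (hF : F.IsHomogeneous e) (i : ℕ) :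
    (dehom F).coeff i =
      if i ≤ e then coeff (Finsupp.single 0 (e - i) + Finsupp.single 1 i) F else 0 := by
  have h : (dehom F).coeff i = ∑ m ∈ F.support, if i = m 1 then coeff m F else 0 := by
    unfold dehom
    rw [aeval_def, eval₂_eq', Polynomial.finsetSum_coeff]
    refine Finset.sum_congr rfl fun m _ => ?_
    simp [Fin.prod_univ_two, Polynomial.coeff_X_pow]
  rw [h]
  split_ifs with hi
  · rw [Finset.sum_eq_single (Finsupp.single 0 (e - i) + Finsupp.single 1 i)]
    · simp
    · intro m hm hne
      rw [if_neg]
      rintro rfl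
      have hs := hF.exponents_add (mem_support_iff.1 hm)
      apply hne
      conv_lhs => rw [finsupp_fin_two_eq m]
      congr 2
      omega
    · intro hm
      rw [notMem_support_iff.1 hm, ite_self]
  · refine Finset.sum_eq_zero fun m hm => ?_
    have hs := hF.exponents_add (mem_support_iff.1 hm)
    rw [if_neg (by omega)]

lemma natDegree_dehom_le {F : MvPolynomial (Fin 2) k} {e : ℕ} (hF : F.IsHomogeneous e) :
    (dehom F).natDegree ≤ e := by
  rw [Polynomial.natDegree_le_iff_coeff_eq_zero]
  intro i hi
  rw [coeff_dehom hF, if_neg (by omega)]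

/-- The resultant of two binary forms of degrees `m` and `n`. -/
def formRes (m n : ℕ) (F G : MvPolynomial (Fin 2) k) : k :=
  Polynomial.resultant (dehom G) (dehom F) n m

lemma bres_eq_formRes {e : ℕ} {F G : MvPolynomial (Fin 2) k} (hF : F.IsHomogeneous e)
    (hG : G.IsHomogeneous e) : bres e F G = formRes e e F G := by
  unfold bres formRes Polynomial.resultant
  rw [← Matrix.det_transpose]
  congr 1
  ext j i
  simp only [Matrix.transpose_apply, sylv, Polynomial.sylvester, Matrix.of_apply, Set.mem_Icc]
  refine Fin.addCases (fun i => ?_) (fun i => ?_) i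
  · simp only [Fin.addCases_left, Fin.val_castAdd, i.2, dif_pos]
    split_ifs with h
    · rw [coeff_dehom hF, if_pos (by omega)]; rfl
    · rfl
  · simp only [Fin.addCases_right, Fin.val_natAdd]
    rw [dif_neg (by omega)]
    by_cases h : (i : ℕ) ≤ j ∧ (j : ℕ) ≤ i + e
    · rw [dif_pos (by omega), if_pos h, coeff_dehom hG, if_pos (by omega)]
      simp only [coeffVec, Nat.add_sub_cancel_left]
    · rw [dif_neg (by omega), if_neg h]

lemma resultant_mul_right_of_le (f g₁ g₂ : Polynomial k) {m n₁ n₂ : ℕ} (hm : f.natDegree ≤ m)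
    (h₁ : g₁.natDegree ≤ n₁) (h₂ : g₂.natDegree ≤ n₂) :
    Polynomial.resultant f (g₁ * g₂) m (n₁ + n₂) =
      Polynomial.resultant f g₁ m n₁ * Polynomial.resultant f g₂ m n₂ := by
  obtain ⟨a, rfl⟩ := Nat.exists_eq_add_of_le h₁
  obtain ⟨b, rfl⟩ := Nat.exists_eq_add_of_le h₂
  rw [show g₁.natDegree + a + (g₂.natDegree + b) = g₁.natDegree + g₂.natDegree + (a + b) by ring,
    Polynomial.resultant_add_right_deg _ _ _ _ _ Polynomial.natDegree_mul_le,
    Polynomial.resultant_add_right_deg _ _ _ _ _ le_rfl,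
    Polynomial.resultant_add_right_deg _ _ _ _ _ le_rfl,
    Polynomial.resultant_mul_right _ _ _ _ hm]
  ring

lemma resultant_mul_left_of_le (f₁ f₂ g : Polynomial k) {m₁ m₂ n : ℕ} (hn : g.natDegree ≤ n)
    (h₁ : f₁.natDegree ≤ m₁) (h₂ : f₂.natDegree ≤ m₂) :
    Polynomial.resultant (f₁ * f₂) g (m₁ + m₂) n =
      Polynomial.resultant f₁ g m₁ n * Polynomial.resultant f₂ g m₂ n := by
  rw [Polynomial.resultant_comm, resultant_mul_right_of_le _ _ _ hn h₁ h₂,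
    Polynomial.resultant_comm f₁, Polynomial.resultant_comm f₂, add_mul, pow_add]
  ring

lemma formRes_mul_left {m₁ m₂ n : ℕ} {F₁ F₂ G : MvPolynomial (Fin 2) k}
    (h₁ : F₁.IsHomogeneous m₁) (h₂ : F₂.IsHomogeneous m₂) (hG : G.IsHomogeneous n) :
    formRes (m₁ + m₂) n (F₁ * F₂) G = formRes m₁ n F₁ G * formRes m₂ n F₂ G := by
  unfold formRes
  rw [map_mul, resultant_mul_right_of_le _ _ _ (natDegree_dehom_le hG) (natDegree_dehom_le h₁)
    (natDegree_dehom_le h₂)]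

lemma formRes_mul_right {m n₁ n₂ : ℕ} {F G₁ G₂ : MvPolynomial (Fin 2) k}
    (hF : F.IsHomogeneous m) (h₁ : G₁.IsHomogeneous n₁) (h₂ : G₂.IsHomogeneous n₂) :
    formRes m (n₁ + n₂) F (G₁ * G₂) = formRes m n₁ F G₁ * formRes m n₂ F G₂ := by
  unfold formRes
  rw [map_mul, resultant_mul_left_of_le _ _ _ (natDegree_dehom_le hF) (natDegree_dehom_le h₁)
    (natDegree_dehom_le h₂)]

lemma formRes_C_left (n : ℕ) (c : k) (G : MvPolynomial (Fin 2) k) :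
    formRes 0 n (C c) G = c ^ n := by
  simp [formRes, dehom]

lemma formRes_C_right (m : ℕ) (c : k) (F : MvPolynomial (Fin 2) k) :
    formRes m 0 F (C c) = c ^ m := by
  simp [formRes, dehom]

lemma resultant_linComb {e : ℕ} {f g : Polynomial k} (hf : f.natDegree ≤ e)
    (hg : g.natDegree ≤ e) (α β γ δ : k) :
    Polynomial.resultant (Polynomial.C α * f + Polynomial.C β * g)
      (Polynomial.C γ * f + Polynomial.C δ * g) e e =
      (α * δ - β * γ) ^ e * Polynomial.resultant f g e e := by
  have hC : ∀ (c : k) (p : Polynomial k), p.natDegree ≤ e → (Polynomial.C c * p).natDegree ≤ e :=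
    fun c p hp => (Polynomial.natDegree_C_mul_le c p).trans hp
  have hdeg : ∀ c : k, (Polynomial.C c).natDegree + e ≤ e := by simp
  by_cases hα : α = 0
  · subst hα
    rw [map_zero, zero_mul, zero_mul, zero_add, Polynomial.resultant_C_mul_left, add_comm, mul_comm (Polynomial.C δ) g,
      add_comm, Polynomial.resultant_add_mul_right, Polynomial.resultant_C_mul_right,
      Polynomial.resultant_comm]
    · rw [pow_mul, zero_sub, ← mul_assoc, ← mul_assoc, ← mul_pow, ← mul_pow]
      rcases Nat.even_or_odd e with he | he
      · rw [he.neg_one_pow, mul_one, he.neg_pow]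
      · rw [he.neg_one_pow, mul_neg_one]
    all_goals first | exact hdeg _ | assumption
  · have h1 : Polynomial.C γ * f + Polynomial.C δ * g =
        Polynomial.C ((α * δ - β * γ) / α) * g +
          (Polynomial.C α * f + Polynomial.C β * g) * Polynomial.C (γ / α) := by
      have e1 : γ = α * (γ / α) := by field_simp
      have e2 : δ = (α * δ - β * γ) / α + β * (γ / α) := by field_simp; ring
      have e3 := congrArg (Polynomial.C : k →+* Polynomial k) e1
      have e4 := congrArg (Polynomial.C : k →+* Polynomial k) e2
      simp only [map_add, map_mul] at e3 e4
      linear_combination f * e3 + g * e4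
    rw [h1, Polynomial.resultant_add_mul_right, Polynomial.resultant_C_mul_right,
      mul_comm (Polynomial.C β) g, Polynomial.resultant_add_mul_left,
      Polynomial.resultant_C_mul_left, ← mul_assoc, ← mul_pow]
    · congr 2; field_simp
    all_goals first | exact hdeg _ | assumption | skip
    exact (Polynomial.natDegree_add_le _ _).trans (max_le (hC _ _ hf) (hC _ _ hg))

lemma formRes_linComb {e : ℕ} {F G : MvPolynomial (Fin 2) k} (hF : F.IsHomogeneous e)
    (hG : G.IsHomogeneous e) (α β γ δ : k) :
    formRes e e (C α * F + C β * G) (C γ * F + C δ * G) = (α * δ - β * γ) ^ e * formRes e e F G := by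
  unfold formRes
  have h : ∀ a b : k, dehom (C a * F + C b * G) =
      Polynomial.C b * dehom G + Polynomial.C a * dehom F := by
    intro a b
    simp only [map_add, map_mul]
    simp [dehom, add_comm]
  rw [← mul_comm δ α, ← mul_comm γ β, ← resultant_linComb (natDegree_dehom_le hG)
    (natDegree_dehom_le hF), h, h]

lemma formRes_X : formRes 1 1 (X 0) (X 1 : MvPolynomial (Fin 2) k) = 1 := by
  have h0 : dehom (X 0 : MvPolynomial (Fin 2) k) = Polynomial.C 1 := by simp [dehom]
  have h1 : dehom (X 1 : MvPolynomial (Fin 2) k) = Polynomial.X := by simp [dehom]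
  rw [formRes, h0, h1, Polynomial.resultant_C_right]
  simp

lemma formRes_linForm_linForm (a b a' b' : k) :
    formRes 1 1 (linForm a b) (linForm a' b') = a * b' - b * a' := by
  have h : ∀ a b : k, linForm a b = C b * X 0 + C (-a) * X 1 := by
    intro a b; simp [linForm]; ring
  rw [h, h, formRes_linComb (isHomogeneous_X _ _) (isHomogeneous_X _ _), formRes_X]
  ring

lemma comp2_linForm (a b : k) (f g : MvPolynomial (Fin 2) k) :
    comp2 (linForm a b) f g = C b * f + C (-a) * g := by
  simp [comp2, linForm, algebraMap_eq]; ring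

lemma comp2_mul (P Q f g : MvPolynomial (Fin 2) k) :
    comp2 (P * Q) f g = comp2 P f g * comp2 Q f g := map_mul _ _ _

lemma comp2_C (c : k) (f g : MvPolynomial (Fin 2) k) : comp2 (C c) f g = C c := by
  simp [comp2]

variable [IsAlgClosed k]

lemma formRes_linForm_left {a b : k} {n : ℕ} {G : MvPolynomial (Fin 2) k}
    (hG : G.IsHomogeneous n) : formRes 1 n (linForm a b) G = eval ![a, b] G := by
  refine binaryForm_induction
    (P := fun n G => formRes 1 n (linForm a b) G = eval ![a, b] G) ?_ ?_ hG
  · intro c; simp [formRes_C_right]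
  · intro a' b' n H _ hH ih
    rw [add_comm, formRes_mul_right (linForm_isHomogeneous _ _) (linForm_isHomogeneous _ _) hH,
      ih, map_mul, formRes_linForm_linForm, eval_linForm]
    ring

lemma formRes_ne_zero {m n : ℕ} {F G : MvPolynomial (Fin 2) k} (hF : F.IsHomogeneous m)
    (hG : G.IsHomogeneous n) (hF0 : F ≠ 0) (h : NoCommonZero F G) : formRes m n F G ≠ 0 := by
  refine binaryForm_induction (P := fun m F => F ≠ 0 → NoCommonZero F G → formRes m n F G ≠ 0)
    ?_ ?_ hF hF0 h
  · intro c hc _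
    rw [formRes_C_left]
    exact pow_ne_zero _ fun h => hc (by rw [h, map_zero])
  · intro a b m H hab hH ih hne hz
    rw [add_comm, formRes_mul_left (linForm_isHomogeneous _ _) hH hG, formRes_linForm_left hG]
    refine mul_ne_zero (fun h0 => hab (hz a b ?_ h0))
      (ih (fun h0 => hne (by rw [h0, mul_zero])) fun x y hx hy => hz x y ?_ hy)
    · rw [map_mul, eval_linForm]; ring
    · rw [map_mul, hx, mul_zero]

lemma formRes_comp2 {m n e : ℕ} {F G f g : MvPolynomial (Fin 2) k} (hF : F.IsHomogeneous m)
    (hG : G.IsHomogeneous n) (hf : f.IsHomogeneous e) (hg : g.IsHomogeneous e) :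
    formRes (e * m) (e * n) (comp2 F f g) (comp2 G f g) =
      formRes m n F G ^ e * formRes e e f g ^ (m * n) := by
  have hlin : ∀ a b : k, (comp2 (linForm a b) f g).IsHomogeneous e := fun a b => by
    simpa using comp2_isHomogeneous (linForm_isHomogeneous a b) hf hg
  have hleft : ∀ (a b : k) {n : ℕ} {G : MvPolynomial (Fin 2) k}, G.IsHomogeneous n →
      formRes e (e * n) (comp2 (linForm a b) f g) (comp2 G f g) =
        formRes 1 n (linForm a b) G ^ e * formRes e e f g ^ n := by
    intro a b n G hG
    refine binaryForm_induction (P := fun n G =>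
      formRes e (e * n) (comp2 (linForm a b) f g) (comp2 G f g) =
        formRes 1 n (linForm a b) G ^ e * formRes e e f g ^ n) ?_ ?_ hG
    · intro c
      rw [comp2_C, mul_zero, formRes_C_right, formRes_C_right]; ring
    · intro a' b' n H _ hH ih
      rw [add_comm, formRes_mul_right (linForm_isHomogeneous _ _) (linForm_isHomogeneous _ _) hH,
        comp2_mul, mul_add, mul_one, formRes_mul_right (hlin _ _) (hlin _ _)
        (comp2_isHomogeneous hH hf hg), ih, comp2_linForm, comp2_linForm,
        formRes_linComb hf hg, formRes_linForm_linForm]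
      rw [pow_add, mul_pow, pow_one, show b * -a' - -a * b' = a * b' - b * a' by ring]
      ring
  refine binaryForm_induction (P := fun m F =>
    formRes (e * m) (e * n) (comp2 F f g) (comp2 G f g) =
      formRes m n F G ^ e * formRes e e f g ^ (m * n)) ?_ ?_ hF
  · intro c
    rw [comp2_C, mul_zero, formRes_C_left, formRes_C_left]; ring
  · intro a b m H _ hH ih
    rw [add_comm, formRes_mul_left (linForm_isHomogeneous _ _) hH hG, comp2_mul, mul_add, mul_one,
      formRes_mul_left (hlin _ _) (comp2_isHomogeneous hH hf hg)
      (comp2_isHomogeneous hG hf hg), ih, hleft a b hG]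
    ring

lemma bres_ne_zero {d : ℕ} (hd : 1 ≤ d) {F G : MvPolynomial (Fin 2) k} (hF : F.IsHomogeneous d)
    (hG : G.IsHomogeneous d) (h : NoCommonZero F G) : bres d F G ≠ 0 := by
  rw [bres_eq_formRes hF hG]
  refine formRes_ne_zero hF hG ?_ h
  rintro rfl
  obtain ⟨n, rfl⟩ := Nat.exists_eq_add_of_le' hd
  obtain ⟨a, b, hab, h0⟩ := exists_zero_of_isHomogeneous_succ hG
  exact hab (h a b (map_zero _) h0)

lemma bres_conjForms {d : ℕ} {F G : MvPolynomial (Fin 2) k} (hF : F.IsHomogeneous d)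
    (hG : G.IsHomogeneous d) (M : GL (Fin 2) k) :
    bres d (conjForms M F G).1 (conjForms M F G).2 =
      M⁻¹.val.det ^ d * M.val.det ^ (d * d) * bres d F G := by
  obtain ⟨h1, h2⟩ := conjForms_isHomogeneous M hF hG
  have hX : ∀ a b : k, (C a * X 0 + C b * X 1 : MvPolynomial (Fin 2) k).IsHomogeneous 1 :=
    fun a b => (isHomogeneous_C_mul_X _ _).add (isHomogeneous_C_mul_X _ _)
  rw [bres_eq_formRes h1 h2, bres_eq_formRes hF hG]
  have h3 := formRes_comp2 hF hG (hX (M.val 0 0) (M.val 0 1)) (hX (M.val 1 0) (M.val 1 1))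
  rw [formRes_linComb (isHomogeneous_X _ _) (isHomogeneous_X _ _), formRes_X, one_mul,
    pow_one, pow_one, mul_one] at h3
  simp only [conjForms]
  rw [formRes_linComb (linSubst_isHomogeneous _ hF) (linSubst_isHomogeneous _ hG), mul_assoc,
    Matrix.det_fin_two, Matrix.det_fin_two, mul_comm (_ ^ (d * d)), ← h3]
  rfl

/-- The exponent of the resultant of `(F, G)` in the resultant of its `n`-th iterate. -/
def iterExponent (d : ℕ) : ℕ → ℕ
  | 0 => 0
  | n + 1 => d ^ n + d * d * iterExponent d n

lemma bres_pairIter {d : ℕ} {F G : MvPolynomial (Fin 2) k} (hF : F.IsHomogeneous d)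
    (hG : G.IsHomogeneous d) (n : ℕ) :
    bres (d ^ n) (pairIter F G n).1 (pairIter F G n).2 = bres d F G ^ iterExponent d n := by
  have hh := pairIter_isHomogeneous hF hG
  rw [bres_eq_formRes (hh n).1 (hh n).2, bres_eq_formRes hF hG]
  induction n with
  | zero => simp [pairIter, iterExponent, formRes_X]
  | succ n ih =>
    rw [pow_succ, pairIter, formRes_comp2 hF hG (hh n).1 (hh n).2, ih, iterExponent, pow_add,
      ← pow_mul]
    ring

lemma iterExponent_eq {d : ℕ} (hd : 2 ≤ d) (n : ℕ) :
    (iterExponent d n : ℝ) =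
      (d : ℝ) ^ n * ((d : ℝ) ^ n - 1) / ((d : ℝ) * ((d : ℝ) - 1)) := by
  have h2 : (2 : ℝ) ≤ d := by exact_mod_cast hd
  have h1 : (d : ℝ) - 1 ≠ 0 := by linarith
  have h0 : (d : ℝ) ≠ 0 := by linarith
  induction n with
  | zero => simp [iterExponent]
  | succ n ih =>
    rw [iterExponent]; push_cast; rw [ih]
    field_simp
    ring

end Resultants

section Stability

variable {k : Type*} [Field k]

/-- The instability of a pair of binary forms of degree `d` at the point `[a : b]`. -/
def UnstableAt (d : ℕ) (F G : MvPolynomial (Fin 2) k) (a b : k) : Prop :=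
  ∃ m : ℕ, d ≤ 2 * m ∧ linForm a b ^ m ∣ F ∧ linForm a b ^ m ∣ G ∧
    linForm a b ^ (m + 1) ∣ X 1 * F - X 0 * G

/-- The numerical criterion for semistability of a pair of binary forms of degree `d`. -/
def SemistablePair (d : ℕ) (F G : MvPolynomial (Fin 2) k) : Prop :=
  ∃ (A F0 G0 : MvPolynomial (Fin 2) k) (e : ℕ),
    e ≤ d ∧ A.IsHomogeneous (d - e) ∧ F0.IsHomogeneous e ∧ G0.IsHomogeneous e ∧
    F = A * F0 ∧ G = A * G0 ∧ IsRelPrime F0 G0 ∧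
    ∀ (a b : k), ¬(a = 0 ∧ b = 0) → ∀ r : ℕ, linForm a b ^ r ∣ A →
        2 * r ≤ d + 1 ∧ (d ≤ 2 * r → b * eval ![a, b] F0 ≠ a * eval ![a, b] G0)

lemma movingForm_isHomogeneous {F G : MvPolynomial (Fin 2) k} {e : ℕ} (hF : F.IsHomogeneous e)
    (hG : G.IsHomogeneous e) : (X 1 * F - X 0 * G).IsHomogeneous (1 + e) :=
  ((isHomogeneous_X _ _).mul hF).sub ((isHomogeneous_X _ _).mul hG)

lemma linForm_dvd_movingForm_iff {F G : MvPolynomial (Fin 2) k} {e : ℕ} (hF : F.IsHomogeneous e)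
    (hG : G.IsHomogeneous e) {a b : k} (h : ¬(a = 0 ∧ b = 0)) :
    linForm a b ∣ X 1 * F - X 0 * G ↔ b * eval ![a, b] F = a * eval ![a, b] G := by
  rw [linForm_dvd_iff h (movingForm_isHomogeneous hF hG)]
  simp [sub_eq_zero]

lemma SemistablePair.not_unstableAt {d : ℕ} {F G : MvPolynomial (Fin 2) k}
    (hs : SemistablePair d F G) {a b : k} (h : ¬(a = 0 ∧ b = 0)) : ¬ UnstableAt d F G a b := by
  rintro ⟨m, hm, hmF, hmG, hmo⟩
  obtain ⟨A, F0, G0, e, -, -, hF0, hG0, rfl, rfl, hrp, hA⟩ := hs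
  have hp : Prime (linForm a b) := (linForm_irreducible h).prime
  have hmA : linForm a b ^ m ∣ A := by
    by_cases h1 : linForm a b ∣ F0
    · exact hp.pow_dvd_of_dvd_mul_right m
        (fun h2 => hp.not_isUnit (hrp h1 h2)) hmG
    · exact hp.pow_dvd_of_dvd_mul_right m h1 hmF
  have h3 := (hA a b h m hmA).2 hm
  rw [show X 1 * (A * F0) - X 0 * (A * G0) = A * (X 1 * F0 - X 0 * G0) by ring] at hmo
  have h4 := (hA a b h (m + 1) (hp.pow_dvd_of_dvd_mul_right _
    (fun h5 => h3 ((linForm_dvd_movingForm_iff hF0 hG0 h).1 h5)) hmo)).1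
  omega

lemma exists_common_factor {d : ℕ} {F G : MvPolynomial (Fin 2) k} (hF : F.IsHomogeneous d)
    (hG : G.IsHomogeneous d) (h : ¬(F = 0 ∧ G = 0)) :
    ∃ (A F0 G0 : MvPolynomial (Fin 2) k) (e : ℕ), e ≤ d ∧ A.IsHomogeneous (d - e) ∧
      F0.IsHomogeneous e ∧ G0.IsHomogeneous e ∧ F = A * F0 ∧ G = A * G0 ∧
      NoCommonZero F0 G0 := by
  induction d generalizing F G with
  | zero =>
    refine ⟨1, F, G, 0, le_rfl, by simpa using isHomogeneous_one _ _, hF, hG, by simp, by simp, ?_⟩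
    intro a b ha hb
    rw [totalDegree_eq_zero_iff_eq_C.1 ((totalDegree_zero_iff_isHomogeneous _).2 hF), eval_C] at ha
    rw [totalDegree_eq_zero_iff_eq_C.1 ((totalDegree_zero_iff_isHomogeneous _).2 hG), eval_C] at hb
    refine absurd ⟨?_, ?_⟩ h
    · rw [totalDegree_eq_zero_iff_eq_C.1 ((totalDegree_zero_iff_isHomogeneous _).2 hF), ha, C_0]
    · rw [totalDegree_eq_zero_iff_eq_C.1 ((totalDegree_zero_iff_isHomogeneous _).2 hG), hb, C_0]
  | succ d ih =>
    by_cases hz : NoCommonZero F G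
    · exact ⟨1, F, G, d + 1, le_rfl, by simpa using isHomogeneous_one _ _, hF, hG, by simp,
        by simp, hz⟩
    · unfold NoCommonZero at hz
      push Not at hz
      obtain ⟨a, b, ha, hb, hab⟩ := hz
      have hab' : ¬(a = 0 ∧ b = 0) := fun h => hab h.1 h.2
      obtain ⟨P, hP, rfl⟩ := exists_isHomogeneous_of_linForm_dvd hF
        ((linForm_dvd_iff hab' hF).2 ha)
      obtain ⟨Q, hQ, rfl⟩ := exists_isHomogeneous_of_linForm_dvd hG
        ((linForm_dvd_iff hab' hG).2 hb)
      obtain ⟨A, F0, G0, e, he, hA, hF0, hG0, rfl, rfl, hn⟩ := ih hP hQ (by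
        rintro ⟨rfl, rfl⟩; simp at h)
      refine ⟨linForm a b * A, F0, G0, e, by omega, ?_, hF0, hG0, by ring, by ring, hn⟩
      rw [show d + 1 - e = 1 + (d - e) by omega]
      exact (linForm_isHomogeneous a b).mul hA

variable [IsAlgClosed k]

lemma semistablePair_iff {d : ℕ} {F G : MvPolynomial (Fin 2) k} (hF : F.IsHomogeneous d)
    (hG : G.IsHomogeneous d) :
    SemistablePair d F G ↔ ∀ a b : k, ¬(a = 0 ∧ b = 0) → ¬ UnstableAt d F G a b := by
  refine ⟨fun h a b hab => h.not_unstableAt hab, fun h => ?_⟩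
  have h0 : ¬(F = 0 ∧ G = 0) := by
    rintro ⟨rfl, rfl⟩
    exact h 0 1 (by simp) ⟨d, by omega, by simp, by simp, by simp⟩
  obtain ⟨A, F0, G0, e, he, hA, hF0, hG0, rfl, rfl, hn⟩ := exists_common_factor hF hG h0
  refine ⟨A, F0, G0, e, he, hA, hF0, hG0, rfl, rfl, hn.isRelPrime hF0 hG0, ?_⟩
  intro a b hab r hr
  have hmo : X 1 * (A * F0) - X 0 * (A * G0) = A * (X 1 * F0 - X 0 * G0) := by ring
  constructor
  · by_contra! hlt
    obtain ⟨m, rfl⟩ : ∃ m, r = m + 1 := ⟨r - 1, by omega⟩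
    have hm : linForm a b ^ m ∣ A := (pow_dvd_pow _ (Nat.le_succ m)).trans hr
    refine h a b hab ⟨m, by omega, hm.mul_right _, hm.mul_right _, ?_⟩
    rw [hmo]
    exact hr.mul_right _
  · intro hdr heq
    refine h a b hab ⟨r, hdr, hr.mul_right _, hr.mul_right _, ?_⟩
    rw [hmo, pow_succ]
    exact mul_dvd_mul hr ((linForm_dvd_movingForm_iff hF0 hG0 hab).2 heq)

end Stability

section StabilityConj

variable {k : Type*} [Field k]

lemma linSubst_linForm (U : Matrix (Fin 2) (Fin 2) k) (x y : k) :
    linSubst U (linForm (U 0 0 * x + U 0 1 * y) (U 1 0 * x + U 1 1 * y)) =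
      C U.det * linForm x y := by
  simp only [linForm, map_sub, map_mul, map_add, linSubst_C, linSubst_X_zero, linSubst_X_one,
    Matrix.det_fin_two]
  ring

lemma movingForm_conjForms (U : GL (Fin 2) k) (F G : MvPolynomial (Fin 2) k) :
    C U.val.det * (X 1 * (conjForms U F G).1 - X 0 * (conjForms U F G).2) =
      linSubst U.val (X 1 * F - X 0 * G) := by
  obtain ⟨h1, h2⟩ := mul_conjForms U F G
  simp only [map_sub, map_mul, ← h1, ← h2, linSubst_X_zero, linSubst_X_one, Matrix.det_fin_two]
  ring

lemma UnstableAt.conjForms {d : ℕ} {F G : MvPolynomial (Fin 2) k} (U : GL (Fin 2) k) {x y : k}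
    (h : UnstableAt d F G (U.val 0 0 * x + U.val 0 1 * y) (U.val 1 0 * x + U.val 1 1 * y)) :
    UnstableAt d (conjForms U F G).1 (conjForms U F G).2 x y := by
  have hu : IsUnit (C U.val.det : MvPolynomial (Fin 2) k) :=
    ((Matrix.isUnit_iff_isUnit_det _).1 U.isUnit).map C
  have key : ∀ {n : ℕ} {H : MvPolynomial (Fin 2) k},
      linForm (U.val 0 0 * x + U.val 0 1 * y) (U.val 1 0 * x + U.val 1 1 * y) ^ n ∣ H →
        linForm x y ^ n ∣ linSubst U.val H := by
    intro n H hd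
    have h1 := map_dvd (linSubst U.val) hd
    rw [map_pow, linSubst_linForm, mul_pow] at h1
    exact (Dvd.intro_left _ rfl).trans h1
  obtain ⟨m, hm, h1, h2, h3⟩ := h
  refine ⟨m, hm, ?_, ?_, ?_⟩
  · exact dvd_add ((key h1).mul_left _) ((key h2).mul_left _)
  · exact dvd_add ((key h1).mul_left _) ((key h2).mul_left _)
  · have := key h3
    rwa [← movingForm_conjForms, hu.dvd_mul_left] at this

lemma unstableAt_conjForms_iff {d : ℕ} {F G : MvPolynomial (Fin 2) k} (U : GL (Fin 2) k) {x y : k} :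
    UnstableAt d (conjForms U F G).1 (conjForms U F G).2 x y ↔
      UnstableAt d F G (U.val 0 0 * x + U.val 0 1 * y) (U.val 1 0 * x + U.val 1 1 * y) := by
  refine ⟨fun h => ?_, fun h => h.conjForms U⟩
  have h1 := UnstableAt.conjForms (d := d) (F := (_root_.conjForms U F G).1)
    (G := (_root_.conjForms U F G).2) U⁻¹ (x := U.val 0 0 * x + U.val 0 1 * y)
    (y := U.val 1 0 * x + U.val 1 1 * y)
  rw [← conjForms_mul, mul_inv_cancel, conjForms_one] at h1
  apply h1
  have hi := GL_two_mul_inv U⁻¹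
  rw [inv_inv] at hi
  obtain ⟨e1, e2, e3, e4⟩ := hi
  convert h using 1
  · linear_combination x * e1 + y * e2
  · linear_combination x * e3 + y * e4

lemma X_pow_dvd_iff_coeff {σ : Type*} {S : Type*} [CommSemiring S] (i : σ) (n : ℕ)
    (H : MvPolynomial σ S) :
    (X i ^ n ∣ H) ↔ ∀ m, H.coeff m ≠ 0 → n ≤ m i := by
  classical
  rw [X_pow_eq_monomial, monomial_one_dvd_iff_modMonomial_eq_zero]
  constructor
  · intro h m hm
    by_contra! hlt
    apply hm
    have hm' : ¬ Finsupp.single i n ≤ m := by rwa [Finsupp.single_le_iff, not_le]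
    rw [← coeff_modMonomial_of_not_le H hm', h, coeff_zero]
  · intro h
    ext m
    rw [coeff_zero]
    by_cases hle : Finsupp.single i n ≤ m
    · exact coeff_modMonomial_of_le _ hle
    · rw [coeff_modMonomial_of_not_le _ hle]
      by_contra hm
      exact hle (Finsupp.single_le_iff.2 (h m hm))

lemma unstableAt_zero_one_iff {d : ℕ} {F G : MvPolynomial (Fin 2) k} :
    UnstableAt d F G 0 1 ↔ (∀ m, F.coeff m ≠ 0 → d + 2 ≤ 2 * m 0) ∧
      ∀ m, G.coeff m ≠ 0 → d ≤ 2 * m 0 := by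
  have hl : linForm 0 1 = (X 0 : MvPolynomial (Fin 2) k) := by simp [linForm]
  have h1 : ∀ m : ℕ, (X 0 ^ m ∣ F ∧ X 0 ^ m ∣ G ∧ X 0 ^ (m + 1) ∣ X 1 * F - X 0 * G) ↔
      (X 0 ^ (m + 1) ∣ F ∧ X 0 ^ m ∣ G) := by
    intro m
    have hX : Prime (X 0 : MvPolynomial (Fin 2) k) := X_prime
    have hX1 : ¬ (X 0 : MvPolynomial (Fin 2) k) ∣ X 1 := by
      rw [X_dvd_X]; simp
    constructor
    · rintro ⟨-, h2, h3⟩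
      refine ⟨?_, h2⟩
      have h4 : (X 0 : MvPolynomial (Fin 2) k) ^ (m + 1) ∣ X 0 * G := by
        rw [pow_succ']; exact mul_dvd_mul_left _ h2
      exact hX.pow_dvd_of_dvd_mul_left _ hX1 ((dvd_sub_left h4).1 h3)
    · rintro ⟨h2, h3⟩
      refine ⟨(pow_dvd_pow _ (Nat.le_succ m)).trans h2, h3, dvd_sub (h2.mul_left _) ?_⟩
      rw [pow_succ']; exact mul_dvd_mul_left _ h3
  unfold UnstableAt
  rw [hl]
  simp only [h1]
  simp only [X_pow_dvd_iff_coeff]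
  constructor
  · rintro ⟨m, hm, h2, h3⟩
    exact ⟨fun n hn => by have := h2 n hn; omega, fun n hn => by have := h3 n hn; omega⟩
  · rintro ⟨h2, h3⟩
    exact ⟨(d + 1) / 2, by omega, fun n hn => by have := h2 n hn; omega,
      fun n hn => by have := h3 n hn; omega⟩

end StabilityConj

section ResidueField

variable {K : Type} [NontriviallyNormedField K] [IsUltrametricDist K]

/-- The reduction homomorphism from the ring of integers to the residue field. -/
def resMap (K : Type) [NontriviallyNormedField K] [IsUltrametricDist K] : intRing K →+* kk K :=
  Ideal.Quotient.mk (maxIdl K)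

lemma resMap_surjective : Function.Surjective (resMap K) := Ideal.Quotient.mk_surjective

lemma resMap_eq_zero_iff {x : intRing K} : resMap K x = 0 ↔ ‖(x : K)‖ < 1 :=
  Ideal.Quotient.eq_zero_iff_mem

lemma resMap_ne_zero_iff {x : intRing K} : resMap K x ≠ 0 ↔ ‖(x : K)‖ = 1 := by
  rw [Ne, resMap_eq_zero_iff, not_lt]
  exact ⟨fun h => le_antisymm x.2 h, fun h => h.ge⟩

lemma isUnit_intRing_iff {x : intRing K} : IsUnit x ↔ ‖(x : K)‖ = 1 := by
  constructor
  · rintro ⟨u, rfl⟩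
    have h1 : ‖((u : intRing K) : K)‖ * ‖((u⁻¹.val : intRing K) : K)‖ = 1 := by
      rw [← norm_mul, ← Subring.coe_mul, u.mul_inv]; simp
    have h2 : ‖((u : intRing K) : K)‖ ≤ 1 := (u : intRing K).2
    have h3 : ‖((u⁻¹.val : intRing K) : K)‖ ≤ 1 := (u⁻¹.val : intRing K).2
    nlinarith [norm_nonneg ((u : intRing K) : K), norm_nonneg ((u⁻¹.val : intRing K) : K)]
  · intro h
    have h0 : (x : K) ≠ 0 := fun h0 => by simp [h0] at h
    refine IsUnit.of_mul_eq_one (⟨(x : K)⁻¹, ?_⟩ : intRing K) (Subtype.ext ?_)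
    · change ‖(x : K)⁻¹‖ ≤ 1
      rw [norm_inv, h, inv_one]
    · exact mul_inv_cancel₀ h0

instance maxIdl_isMaximal : (maxIdl K).IsMaximal := by
  rw [Ideal.isMaximal_iff]
  constructor
  · change ¬ ‖((1 : intRing K) : K)‖ < 1
    simp
  · intro J x _ hx hxJ
    have h1 : ‖(x : K)‖ = 1 := resMap_ne_zero_iff.1 (fun h => hx (resMap_eq_zero_iff.1 h))
    rw [Ideal.eq_top_of_isUnit_mem J hxJ (isUnit_intRing_iff.2 h1)]
    trivial

instance residueField : Field (kk K) := Ideal.Quotient.field (maxIdl K)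

lemma mem_intRing_of_monic_root {p : Polynomial (intRing K)} (hp : p.Monic) {x : K}
    (hx : Polynomial.eval₂ (intRing K).subtype x p = 0) : ‖x‖ ≤ 1 := by
  by_contra! hlt
  rw [Polynomial.eval₂_eq_sum_range, Finset.sum_range_succ, hp.coeff_natDegree, map_one, one_mul,
    add_comm] at hx
  have h1 : ‖x‖ ^ p.natDegree = ‖∑ i ∈ Finset.range p.natDegree,
      (intRing K).subtype (p.coeff i) * x ^ i‖ := by
    rw [← norm_pow, eq_neg_of_add_eq_zero_left hx, norm_neg]
  have hpos : 0 < ‖x‖ ^ p.natDegree := by positivity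
  obtain ⟨i, hi, hle⟩ := IsUltrametricDist.exists_norm_finsetSum_le (Finset.range p.natDegree)
    (fun i => (intRing K).subtype (p.coeff i) * x ^ i)
  rcases (Finset.range p.natDegree).eq_empty_or_nonempty with he | he
  · rw [he, Finset.sum_empty, norm_zero] at h1
    exact hpos.ne' h1
  · have hi' := Finset.mem_range.1 (hi he)
    rw [← h1, norm_mul, norm_pow] at hle
    have h2 : ‖(intRing K).subtype (p.coeff i)‖ ≤ 1 := (p.coeff i).2
    have h3 : ‖x‖ ^ i < ‖x‖ ^ p.natDegree := pow_lt_pow_right₀ hlt hi'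
    have h4 : 0 ≤ ‖x‖ ^ i := by positivity
    nlinarith

instance residueField_isAlgClosed [IsAlgClosed K] : IsAlgClosed (kk K) := by
  apply IsAlgClosed.of_exists_root
  intro p hp hirr
  obtain ⟨q, hq, hqd, hqm⟩ := Polynomial.lifts_and_natDegree_eq_and_monic
    (f := resMap K) (Polynomial.lifts_iff_coeff_lifts _ |>.2 fun n =>
      Set.mem_range.2 (resMap_surjective _)) hp
  have hdeg : (q.map (intRing K).subtype).degree ≠ 0 := by
    rw [hqm.degree_map, Polynomial.degree_eq_natDegree hqm.ne_zero, hqd]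
    exact_mod_cast hirr.natDegree_pos.ne'
  obtain ⟨x, hx⟩ := IsAlgClosed.exists_root _ hdeg
  rw [Polynomial.IsRoot, Polynomial.eval_map] at hx
  let y : intRing K := ⟨x, mem_intRing_of_monic_root hqm hx⟩
  refine ⟨resMap K y, ?_⟩
  have h1 : q.eval y = 0 := by
    apply (intRing K).subtype_injective
    rw [map_zero, ← hx, ← Polynomial.eval₂_hom]
    rfl
  rw [← hq, Polynomial.eval_map, Polynomial.eval₂_hom, h1, map_zero]

end ResidueField

section IntegralForms

variable {K : Type} [NontriviallyNormedField K] [IsUltrametricDist K]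

/-- The inclusion of integral forms into forms over the field. -/
abbrev intMap (K : Type) [NontriviallyNormedField K] [IsUltrametricDist K] :
    MvPolynomial (Fin 2) (intRing K) →+* MvPolynomial (Fin 2) K :=
  MvPolynomial.map (intRing K).subtype

lemma exists_intMap_eq {F : MvPolynomial (Fin 2) K} (hF : ∀ m, ‖F.coeff m‖ ≤ 1) :
    ∃ f, intMap K f = F := by
  have h : F ∈ Set.range (intMap K) := by
    rw [MvPolynomial.mem_range_map_iff_coeffs_subset]
    intro c hc
    obtain ⟨m, -, rfl⟩ := MvPolynomial.mem_coeffs_iff.1 hc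
    exact ⟨⟨_, hF m⟩, rfl⟩
  exact h

lemma intMap_isHomogeneous_iff {f : MvPolynomial (Fin 2) (intRing K)} {d : ℕ} :
    (intMap K f).IsHomogeneous d ↔ f.IsHomogeneous d :=
  ⟨fun h => h.of_map (intRing K).subtype_injective, fun h => h.map _⟩

lemma redPoly_intMap (f : MvPolynomial (Fin 2) (intRing K)) :
    redPoly K (intMap K f) = MvPolynomial.map (resMap K) f := by
  have h : ∀ x : intRing K, redCoeff K ((intRing K).subtype x) = resMap K x := fun x =>
    dif_pos x.2
  unfold redPoly
  rw [MvPolynomial.support_map_of_injective _ (intRing K).subtype_injective]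
  conv_rhs => rw [f.as_sum, map_sum]
  refine Finset.sum_congr rfl fun m _ => ?_
  rw [MvPolynomial.coeff_map, h, MvPolynomial.map_monomial]

end IntegralForms

section GaussNorm

variable {K : Type} [NontriviallyNormedField K] {e : ℕ} {F G : MvPolynomial (Fin 2) K}

lemma isHomogeneous_smul (hF : F.IsHomogeneous e) (c : K) : (c • F).IsHomogeneous e := by
  rw [smul_eq_C_mul]
  exact hF.C_mul c

lemma coeff_eq_coeffVec {m : Fin 2 →₀ ℕ} (hm : m 0 + m 1 = e) (H : MvPolynomial (Fin 2) K) :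
    H.coeff m = coeffVec e H ⟨m 1, by omega⟩ := by
  unfold coeffVec
  conv_lhs => rw [finsupp_fin_two_eq m]
  rw [show m 0 = e - m 1 by omega]

lemma maxNorm_nonneg : 0 ≤ maxNorm K e F G :=
  (le_max_of_le_left (norm_nonneg _)).trans
    (Finset.le_sup' (fun i : Fin (e + 1) => max ‖coeffVec e F i‖ ‖coeffVec e G i‖)
      (Finset.mem_univ 0))

lemma norm_coeff_le_maxNorm_left (hF : F.IsHomogeneous e) (m : Fin 2 →₀ ℕ) :
    ‖F.coeff m‖ ≤ maxNorm K e F G := by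
  by_cases h : F.coeff m = 0
  · rw [h, norm_zero]; exact maxNorm_nonneg
  · rw [coeff_eq_coeffVec (hF.exponents_add h)]
    exact (le_max_left _ _).trans
      (Finset.le_sup' (fun i : Fin (e + 1) => max ‖coeffVec e F i‖ ‖coeffVec e G i‖)
        (Finset.mem_univ _))

lemma norm_coeff_le_maxNorm_right (hG : G.IsHomogeneous e) (m : Fin 2 →₀ ℕ) :
    ‖G.coeff m‖ ≤ maxNorm K e F G := by
  by_cases h : G.coeff m = 0
  · rw [h, norm_zero]; exact maxNorm_nonneg
  · rw [coeff_eq_coeffVec (hG.exponents_add h)]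
    exact (le_max_right _ _).trans
      (Finset.le_sup' (fun i : Fin (e + 1) => max ‖coeffVec e F i‖ ‖coeffVec e G i‖)
        (Finset.mem_univ _))

lemma exists_maxNorm_eq (e : ℕ) (F G : MvPolynomial (Fin 2) K) :
    ∃ m : Fin 2 →₀ ℕ, m 0 + m 1 = e ∧
      (maxNorm K e F G = ‖F.coeff m‖ ∨ maxNorm K e F G = ‖G.coeff m‖) := by
  obtain ⟨i, -, hi⟩ := Finset.exists_mem_eq_sup' Finset.univ_nonempty
    (fun i : Fin (e + 1) => max ‖coeffVec e F i‖ ‖coeffVec e G i‖)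
  refine ⟨Finsupp.single 0 (e - (i : ℕ)) + Finsupp.single 1 (i : ℕ), ?_, ?_⟩
  · have := i.2
    simp; omega
  · rcases max_choice ‖coeffVec e F i‖ ‖coeffVec e G i‖ with h | h
    · left; exact hi.trans h
    · right; exact hi.trans h

lemma maxNorm_le {c : ℝ} (hF : ∀ m, ‖F.coeff m‖ ≤ c) (hG : ∀ m, ‖G.coeff m‖ ≤ c) :
    maxNorm K e F G ≤ c := by
  obtain ⟨m, -, h | h⟩ := exists_maxNorm_eq e F G
  · exact h.trans_le (hF m)
  · exact h.trans_le (hG m)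

lemma maxNorm_smul (c : K) : maxNorm K e (c • F) (c • G) = ‖c‖ * maxNorm K e F G := by
  unfold maxNorm
  rw [Finset.mul₀_sup' (norm_nonneg c)]
  refine Finset.sup'_congr _ rfl fun i _ => ?_
  simp [coeffVec, mul_max_of_nonneg]

lemma maxNorm_pos (hF : F.IsHomogeneous e) (hG : G.IsHomogeneous e) (h : ¬(F = 0 ∧ G = 0)) :
    0 < maxNorm K e F G := by
  refine lt_of_le_of_ne maxNorm_nonneg fun h0 => h ⟨?_, ?_⟩
  · ext m
    simpa [← h0] using norm_coeff_le_maxNorm_left (G := G) hF m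
  · ext m
    simpa [← h0] using norm_coeff_le_maxNorm_right (F := F) hG m

lemma normalized_iff (hF : F.IsHomogeneous e) (hG : G.IsHomogeneous e) :
    Normalized K F G ↔ maxNorm K e F G = 1 := by
  constructor
  · rintro ⟨h1, h2, m, h3⟩
    refine le_antisymm (maxNorm_le h1 h2) ?_
    rcases h3 with h3 | h3
    · rw [← h3]; exact norm_coeff_le_maxNorm_left hF m
    · rw [← h3]; exact norm_coeff_le_maxNorm_right hG m
  · intro h
    refine ⟨fun m => h ▸ norm_coeff_le_maxNorm_left hF m,
      fun m => h ▸ norm_coeff_le_maxNorm_right hG m, ?_⟩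
    obtain ⟨m, -, h1⟩ := exists_maxNorm_eq e F G
    exact ⟨m, by rwa [h, eq_comm, @eq_comm _ (1 : ℝ)] at h1⟩

lemma exists_normalizing_scalar (hF : F.IsHomogeneous e) (hG : G.IsHomogeneous e)
    (h : ¬(F = 0 ∧ G = 0)) : ∃ c : Kˣ, Normalized K ((c : K) • F) ((c : K) • G) := by
  have hpos := maxNorm_pos hF hG h
  obtain ⟨c, hc⟩ : ∃ c : K, ‖c‖ = maxNorm K e F G := by
    obtain ⟨m, -, h1 | h1⟩ := exists_maxNorm_eq e F G
    · exact ⟨_, h1.symm⟩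
    · exact ⟨_, h1.symm⟩
  have hc0 : c ≠ 0 := by
    rintro rfl
    rw [norm_zero] at hc
    exact hpos.ne hc
  refine ⟨(Units.mk0 c hc0)⁻¹, ?_⟩
  rw [normalized_iff (e := e) (isHomogeneous_smul hF _) (isHomogeneous_smul hG _), maxNorm_smul, ← hc]
  simp [hc0]

end GaussNorm

lemma conjForms_smul {S : Type*} [CommRing S] (M : GL (Fin 2) S) (c : S)
    (F G : MvPolynomial (Fin 2) S) :
    conjForms M (c • F) (c • G) = (c • (conjForms M F G).1, c • (conjForms M F G).2) := by
  simp only [conjForms, smul_eq_C_mul, map_mul, linSubst_C]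
  ext1 <;> ring

section Ratio

variable {K : Type} [NontriviallyNormedField K] {d : ℕ} {F G : MvPolynomial (Fin 2) K}

/-- The quantity `‖(F, G)^M‖² / ‖det M‖^(d-1)`, whose logarithm measures the change of the
resultant of the normalized lift under conjugation by `M`. -/
def normRatio (d : ℕ) (M : GL (Fin 2) K) (F G : MvPolynomial (Fin 2) K) : ℝ :=
  maxNorm K d (conjForms M F G).1 (conjForms M F G).2 ^ 2 / ‖M.val.det‖ ^ (d - 1)

lemma norm_det_pos (M : GL (Fin 2) K) : 0 < ‖M.val.det‖ :=
  norm_pos_iff.2 ((Matrix.isUnit_iff_isUnit_det _).1 M.isUnit).ne_zero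

lemma normRatio_mul (M N : GL (Fin 2) K) :
    normRatio d (M * N) F G =
      normRatio d N (conjForms M F G).1 (conjForms M F G).2 / ‖M.val.det‖ ^ (d - 1) := by
  unfold normRatio
  rw [conjForms_mul, Units.val_mul, Matrix.det_mul, norm_mul, mul_pow, mul_comm (_ ^ _),
    div_mul_eq_div_div]

lemma normRatio_smul (M : GL (Fin 2) K) (c : K) :
    normRatio d M (c • F) (c • G) = ‖c‖ ^ 2 * normRatio d M F G := by
  unfold normRatio
  rw [conjForms_smul, maxNorm_smul]
  ring

/-- The scalar matrix `c` in `GL₂`. -/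
abbrev scalarGL (c : Kˣ) : GL (Fin 2) K := Matrix.GeneralLinearGroup.scalar (Fin 2) c

lemma conjForms_scalar (hd : 1 ≤ d) (hF : F.IsHomogeneous d) (hG : G.IsHomogeneous d) (c : Kˣ) :
    conjForms (scalarGL c) F G = ((c : K) ^ (d - 1) • F, (c : K) ^ (d - 1) • G) := by
  have hs : ∀ {H : MvPolynomial (Fin 2) K}, H.IsHomogeneous d →
      linSubst (scalarGL c).val H = C ((c : K) ^ d) * H := by
    intro H hH
    have h1 := comp2_mul_mul hH (C (c : K)) (X 0) (X 1)
    have h2 : comp2 H (X 0) (X 1) = H := by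
      have : (![X 0, X 1] : Fin 2 → MvPolynomial (Fin 2) K) = X := by
        ext1 i; fin_cases i <;> rfl
      rw [comp2, this, aeval_X_left_apply]
    rw [h2, ← C_pow] at h1
    rw [← h1]
    simp [linSubst, comp2, Matrix.GeneralLinearGroup.coe_scalar, Matrix.scalar_apply]
  have hi : (scalarGL c)⁻¹.val = Matrix.diagonal fun _ => (c : K)⁻¹ := by
    rw [← map_inv, Matrix.GeneralLinearGroup.coe_scalar, Matrix.scalar_apply, Units.val_inv_eq_inv_val]
  obtain ⟨n, rfl⟩ := Nat.exists_eq_add_of_le' hd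
  have h1 : (C (c : K)⁻¹ * C ((c : K) ^ (n + 1)) : MvPolynomial (Fin 2) K) = C ((c : K) ^ n) := by
    rw [← C_mul, pow_succ', ← mul_assoc, inv_mul_cancel₀ c.ne_zero, one_mul]
  rw [conjForms, hi, hs hF, hs hG]
  simp only [Matrix.diagonal_apply_eq, ← mul_assoc, h1, smul_eq_C_mul, Nat.add_sub_cancel]
  simp

lemma normRatio_mul_scalar (hd : 1 ≤ d) (hF : F.IsHomogeneous d) (hG : G.IsHomogeneous d)
    (M : GL (Fin 2) K) (c : Kˣ) : normRatio d (M * scalarGL c) F G = normRatio d M F G := by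
  obtain ⟨h1, h2⟩ := conjForms_isHomogeneous M hF hG
  have hc : ‖(c : K)‖ ≠ 0 := (norm_pos_iff.2 c.ne_zero).ne'
  have hdet : (scalarGL c).val.det = (c : K) ^ 2 := by
    simp [Matrix.GeneralLinearGroup.coe_scalar]
  unfold normRatio
  rw [conjForms_mul, conjForms_scalar hd h1 h2, maxNorm_smul, Units.val_mul, Matrix.det_mul, hdet,
    norm_mul, norm_pow, norm_pow, mul_pow, mul_pow, ← pow_mul, ← pow_mul, mul_comm 2 (d - 1)]
  have : ‖(c : K)‖ ^ ((d - 1) * 2) ≠ 0 := pow_ne_zero _ hc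
  rw [mul_comm (‖M.val.det‖ ^ _), mul_div_mul_left _ _ this]

variable [IsUltrametricDist K]

/-- The embedding of `GL₂` of the ring of integers. -/
abbrev intGL (U : GL (Fin 2) (intRing K)) : GL (Fin 2) K :=
  Matrix.GeneralLinearGroup.map (intRing K).subtype U

lemma norm_det_intGL (U : GL (Fin 2) (intRing K)) : ‖(intGL U).val.det‖ = 1 := by
  have h : (intGL U).val.det = (intRing K).subtype U.val.det := by
    rw [RingHom.map_det]; rfl
  rw [h]
  exact isUnit_intRing_iff.1 ((Matrix.isUnit_iff_isUnit_det _).1 U.isUnit)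

lemma maxNorm_conjForms_intGL_le (hF : F.IsHomogeneous d) (hG : G.IsHomogeneous d)
    (U : GL (Fin 2) (intRing K)) :
    maxNorm K d (conjForms (intGL U) F G).1 (conjForms (intGL U) F G).2 ≤ maxNorm K d F G := by
  by_cases h : F = 0 ∧ G = 0
  · obtain ⟨rfl, rfl⟩ := h
    simp [conjForms]
  · obtain ⟨c, hc⟩ := exists_normalizing_scalar hF hG h
    have hpos : 0 < ‖(c : K)‖ := norm_pos_iff.2 c.ne_zero
    obtain ⟨f, hf⟩ := exists_intMap_eq hc.1
    obtain ⟨g, hg⟩ := exists_intMap_eq hc.2.1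
    have h1 : maxNorm K d ((c : K) • (conjForms (intGL U) F G).1)
        ((c : K) • (conjForms (intGL U) F G).2) ≤ 1 := by
      have h2 := conjForms_smul (intGL U) (c : K) F G
      rw [← hf, ← hg, map_conjForms, Prod.mk.injEq] at h2
      rw [← h2.1, ← h2.2]
      refine maxNorm_le (fun m => ?_) (fun m => ?_)
      · rw [MvPolynomial.coeff_map]
        exact (coeff m (conjForms U f g).1).2
      · rw [MvPolynomial.coeff_map]
        exact (coeff m (conjForms U f g).2).2
    rw [normalized_iff (e := d) (isHomogeneous_smul hF _) (isHomogeneous_smul hG _), maxNorm_smul] at hc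
    rw [maxNorm_smul, ← hc] at h1
    exact le_of_mul_le_mul_left h1 hpos

lemma maxNorm_conjForms_intGL (hF : F.IsHomogeneous d) (hG : G.IsHomogeneous d)
    (U : GL (Fin 2) (intRing K)) :
    maxNorm K d (conjForms (intGL U) F G).1 (conjForms (intGL U) F G).2 = maxNorm K d F G := by
  refine le_antisymm (maxNorm_conjForms_intGL_le hF hG U) ?_
  obtain ⟨h1, h2⟩ := conjForms_isHomogeneous (intGL U) hF hG
  have h := maxNorm_conjForms_intGL_le h1 h2 U⁻¹
  rw [← conjForms_mul, intGL, intGL, ← map_mul, mul_inv_cancel, map_one, conjForms_one] at h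
  exact h

lemma normRatio_mul_intGL (hF : F.IsHomogeneous d) (hG : G.IsHomogeneous d) (M : GL (Fin 2) K)
    (U : GL (Fin 2) (intRing K)) : normRatio d (M * intGL U) F G = normRatio d M F G := by
  obtain ⟨h1, h2⟩ := conjForms_isHomogeneous M hF hG
  unfold normRatio
  rw [conjForms_mul, maxNorm_conjForms_intGL h1 h2, Units.val_mul, Matrix.det_mul, norm_mul,
    norm_det_intGL, mul_one]

lemma normRatio_intGL_mul (M : GL (Fin 2) K) (U : GL (Fin 2) (intRing K)) :
    normRatio d (intGL U * M) F G =
      normRatio d M (conjForms (intGL U) F G).1 (conjForms (intGL U) F G).2 := by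
  rw [normRatio_mul, norm_det_intGL, one_pow, div_one]

end Ratio

section Diagonal

variable {K : Type} [NontriviallyNormedField K] {d : ℕ} {F G : MvPolynomial (Fin 2) K}

/-- The matrix `diag(A, 1)`. -/
def diagGL (A : Kˣ) : GL (Fin 2) K where
  val := !![(A : K), 0; 0, 1]
  inv := !![(A : K)⁻¹, 0; 0, 1]
  val_inv := by ext i j; fin_cases i <;> fin_cases j <;> simp
  inv_val := by ext i j; fin_cases i <;> fin_cases j <;> simp

lemma coeff_linSubst_diagGL (A : Kˣ) (H : MvPolynomial (Fin 2) K) (m : Fin 2 →₀ ℕ) :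
    coeff m (linSubst (diagGL A).val H) = (A : K) ^ m 0 * coeff m H := by
  induction H using MvPolynomial.induction_on' with
  | monomial u a =>
    have h : linSubst (diagGL A).val (monomial u a) = monomial u ((A : K) ^ u 0 * a) := by
      have hm : ∀ c : K, monomial u c = C c * (X 0 ^ u 0 * X 1 ^ u 1) := fun c => by
        rw [monomial_eq, Finsupp.prod_fintype _ _ (fun i => pow_zero _), Fin.prod_univ_two]
      rw [hm, hm, map_mul, map_mul, map_pow, map_pow, linSubst_C, linSubst_X_zero,
        linSubst_X_one]
      simp [diagGL]
      ring
    rw [h, coeff_monomial, coeff_monomial]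
    split_ifs with h1
    · rw [h1]
    · rw [mul_zero]
  | add p q hp hq => rw [map_add, coeff_add, coeff_add, hp, hq, mul_add]

lemma coeff_conjForms_diagGL_fst (A : Kˣ) (m : Fin 2 →₀ ℕ) :
    coeff m (conjForms (diagGL A) F G).1 = (A : K)⁻¹ * ((A : K) ^ m 0 * coeff m F) := by
  have h : (diagGL A)⁻¹.val = !![(A : K)⁻¹, 0; 0, 1] := rfl
  rw [conjForms, h]
  simp [coeff_linSubst_diagGL]

lemma coeff_conjForms_diagGL_snd (A : Kˣ) (m : Fin 2 →₀ ℕ) :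
    coeff m (conjForms (diagGL A) F G).2 = (A : K) ^ m 0 * coeff m G := by
  have h : (diagGL A)⁻¹.val = !![(A : K)⁻¹, 0; 0, 1] := rfl
  rw [conjForms, h]
  simp [coeff_linSubst_diagGL]

lemma det_diagGL (A : Kˣ) : (diagGL A).val.det = A := by
  simp [diagGL, Matrix.det_fin_two]

end Diagonal

section Cartan

variable {K : Type} [NontriviallyNormedField K] [IsUltrametricDist K]

/-- The upper unipotent matrix over a commutative ring. -/
def upperGL {S : Type*} [CommRing S] (x : S) : GL (Fin 2) S where
  val := !![1, x; 0, 1]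
  inv := !![1, -x; 0, 1]
  val_inv := by ext i j; fin_cases i <;> fin_cases j <;> simp
  inv_val := by ext i j; fin_cases i <;> fin_cases j <;> simp

/-- The lower unipotent matrix over a commutative ring. -/
def lowerGL {S : Type*} [CommRing S] (x : S) : GL (Fin 2) S where
  val := !![1, 0; x, 1]
  inv := !![1, 0; -x, 1]
  val_inv := by ext i j; fin_cases i <;> fin_cases j <;> simp
  inv_val := by ext i j; fin_cases i <;> fin_cases j <;> simp

/-- The matrix exchanging the coordinates. -/
def swapGL (S : Type*) [CommRing S] : GL (Fin 2) S where
  val := !![0, 1; 1, 0]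
  inv := !![0, 1; 1, 0]
  val_inv := by ext i j; fin_cases i <;> fin_cases j <;> simp
  inv_val := by ext i j; fin_cases i <;> fin_cases j <;> simp

lemma swapGL_mul_self (S : Type*) [CommRing S] : swapGL S * swapGL S = 1 :=
  Units.ext (swapGL S).val_inv

lemma intGL_swapGL_mul_self : intGL (swapGL (intRing K)) * intGL (swapGL (intRing K)) = 1 := by
  rw [intGL, ← map_mul, swapGL_mul_self, map_one]

/-- `N` lies in a double coset of `diag(A, 1)` with `|A| ≤ 1`, up to scalars. -/
def HasCartan (N : GL (Fin 2) K) : Prop :=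
  ∃ (U V : GL (Fin 2) (intRing K)) (A c : Kˣ), ‖(A : K)‖ ≤ 1 ∧
    N = intGL U * (diagGL A * scalarGL c) * intGL V

lemma HasCartan.of_swap_mul {N : GL (Fin 2) K}
    (h : HasCartan (intGL (swapGL (intRing K)) * N)) : HasCartan N := by
  obtain ⟨U, V, A, c, hA, h⟩ := h
  refine ⟨swapGL _ * U, V, A, c, hA, ?_⟩
  rw [show intGL (swapGL (intRing K) * U) = intGL (swapGL (intRing K)) * intGL U from map_mul _ _ _,
    mul_assoc (intGL (swapGL _)), mul_assoc (intGL (swapGL _)), ← h, ← mul_assoc,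
    intGL_swapGL_mul_self, one_mul]

lemma HasCartan.of_mul_swap {N : GL (Fin 2) K}
    (h : HasCartan (N * intGL (swapGL (intRing K)))) : HasCartan N := by
  obtain ⟨U, V, A, c, hA, h⟩ := h
  refine ⟨U, V * swapGL _, A, c, hA, ?_⟩
  rw [show intGL (V * swapGL (intRing K)) = intGL V * intGL (swapGL (intRing K)) from map_mul _ _ _,
    ← mul_assoc, ← h, mul_assoc, intGL_swapGL_mul_self, mul_one]

lemma norm_det_le_of_norm_le {N : Matrix (Fin 2) (Fin 2) K} {c : ℝ} (h : ∀ i j, ‖N i j‖ ≤ c) :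
    ‖N.det‖ ≤ c ^ 2 := by
  have hc : 0 ≤ c := (norm_nonneg _).trans (h 0 0)
  rw [Matrix.det_fin_two, sub_eq_add_neg]
  refine (IsUltrametricDist.norm_add_le_max _ _).trans (max_le ?_ ?_)
  · rw [norm_mul, sq]
    exact mul_le_mul (h _ _) (h _ _) (norm_nonneg _) hc
  · rw [norm_neg, norm_mul, sq]
    exact mul_le_mul (h _ _) (h _ _) (norm_nonneg _) hc

lemma hasCartan_of_forall_norm_le {N : GL (Fin 2) K} (h : ∀ i j, ‖N.val i j‖ ≤ ‖N.val 1 1‖) :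
    HasCartan N := by
  have hdet : N.val.det ≠ 0 := ((Matrix.isUnit_iff_isUnit_det _).1 N.isUnit).ne_zero
  have hf : N.val 1 1 ≠ 0 := by
    intro h0
    apply hdet
    have h1 : ∀ i j, N.val i j = 0 := fun i j => by
      have := h i j
      rwa [h0, norm_zero, norm_le_zero_iff] at this
    rw [Matrix.det_fin_two, h1, h1 0 1]; ring
  have hpos : 0 < ‖N.val 1 1‖ := norm_pos_iff.2 hf
  have hb : ‖N.val 0 1 / N.val 1 1‖ ≤ 1 := by
    rw [norm_div, div_le_one hpos]; exact h 0 1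
  have he : ‖N.val 1 0 / N.val 1 1‖ ≤ 1 := by
    rw [norm_div, div_le_one hpos]; exact h 1 0
  have hA : N.val.det / N.val 1 1 ^ 2 ≠ 0 := div_ne_zero hdet (pow_ne_zero _ hf)
  refine ⟨upperGL ⟨_, hb⟩, lowerGL ⟨_, he⟩, Units.mk0 _ hA, Units.mk0 _ hf, ?_, ?_⟩
  · rw [Units.val_mk0, norm_div, norm_pow, div_le_one (by positivity)]
    exact norm_det_le_of_norm_le h
  · have h1 : (intGL (upperGL (⟨_, hb⟩ : intRing K))).val = !![1, N.val 0 1 / N.val 1 1; 0, 1] := by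
      ext i j; fin_cases i <;> fin_cases j <;> rfl
    have h2 : (intGL (lowerGL (⟨_, he⟩ : intRing K))).val = !![1, 0; N.val 1 0 / N.val 1 1, 1] := by
      ext i j; fin_cases i <;> fin_cases j <;> rfl
    have h3 : (scalarGL (Units.mk0 _ hf)).val = !![N.val 1 1, 0; 0, N.val 1 1] := by
      ext i j; fin_cases i <;> fin_cases j <;> rfl
    have h4 : (diagGL (Units.mk0 _ hA)).val = !![N.val.det / N.val 1 1 ^ 2, 0; 0, 1] := rfl
    apply Units.ext
    rw [Units.val_mul, Units.val_mul, Units.val_mul, h1, h2, h3, h4, Matrix.mul_fin_two,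
      Matrix.mul_fin_two, Matrix.mul_fin_two, Matrix.det_fin_two]
    ext i j
    fin_cases i <;> fin_cases j <;> simp <;> field_simp
    ring

lemma hasCartan (N : GL (Fin 2) K) : HasCartan N := by
  obtain ⟨⟨i, j⟩, -, hij⟩ := Finset.exists_max_image Finset.univ
    (fun p : Fin 2 × Fin 2 => ‖N.val p.1 p.2‖) Finset.univ_nonempty
  have h : ∀ a b, ‖N.val a b‖ ≤ ‖N.val i j‖ := fun a b => hij (a, b) (Finset.mem_univ _)
  have hs : (intGL (swapGL (intRing K))).val = !![0, 1; 1, 0] := by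
    ext i j; fin_cases i <;> fin_cases j <;> rfl
  fin_cases i <;> fin_cases j
  · refine HasCartan.of_swap_mul (HasCartan.of_mul_swap (hasCartan_of_forall_norm_le ?_))
    intro a b
    rw [Units.val_mul, Units.val_mul, hs]
    simp only [Matrix.mul_apply, Fin.sum_univ_two]
    fin_cases a <;> fin_cases b <;> simp
    all_goals exact h _ _
  · refine HasCartan.of_swap_mul (hasCartan_of_forall_norm_le ?_)
    intro a b
    rw [Units.val_mul, hs]
    fin_cases a <;> fin_cases b <;> simp [Matrix.mul_apply, Fin.sum_univ_two]
    all_goals exact h _ _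
  · refine HasCartan.of_mul_swap (hasCartan_of_forall_norm_le ?_)
    intro a b
    rw [Units.val_mul, hs]
    fin_cases a <;> fin_cases b <;> simp [Matrix.mul_apply, Fin.sum_univ_two]
    all_goals exact h _ _
  · exact hasCartan_of_forall_norm_le h

end Cartan

section DiagonalRatio

variable {K : Type} [NontriviallyNormedField K] {d : ℕ} {F G : MvPolynomial (Fin 2) K}

lemma normRatio_diagGL (hd : 1 ≤ d) (A : Kˣ) :
    normRatio d (diagGL A) F G * ‖(A : K)‖ ^ (d + 1) =
      (‖(A : K)‖ * maxNorm K d (conjForms (diagGL A) F G).1 (conjForms (diagGL A) F G).2) ^ 2 := by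
  obtain ⟨e, rfl⟩ := Nat.exists_eq_add_of_le' hd
  have hA : ‖(A : K)‖ ≠ 0 := norm_ne_zero_iff.2 A.ne_zero
  rw [normRatio, det_diagGL, Nat.add_sub_cancel, mul_pow]
  field_simp
  ring

lemma norm_mul_coeff_conjForms_diagGL_fst (A : Kˣ) (m : Fin 2 →₀ ℕ) :
    (‖(A : K)‖ * ‖coeff m (conjForms (diagGL A) F G).1‖) ^ 2 =
      ‖coeff m F‖ ^ 2 * ‖(A : K)‖ ^ (2 * m 0) := by
  have hA : ‖(A : K)‖ ≠ 0 := norm_ne_zero_iff.2 A.ne_zero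
  rw [coeff_conjForms_diagGL_fst, norm_mul, norm_mul, norm_inv, norm_pow, mul_inv_cancel_left₀ hA,
    mul_pow, ← pow_mul, mul_comm, mul_comm (m 0)]

lemma norm_mul_coeff_conjForms_diagGL_snd (A : Kˣ) (m : Fin 2 →₀ ℕ) :
    (‖(A : K)‖ * ‖coeff m (conjForms (diagGL A) F G).2‖) ^ 2 =
      ‖coeff m G‖ ^ 2 * ‖(A : K)‖ ^ (2 * m 0 + 2) := by
  rw [coeff_conjForms_diagGL_snd, norm_mul, norm_pow]
  ring

lemma le_normRatio_diagGL_fst (hd : 1 ≤ d) (hF : F.IsHomogeneous d) (hG : G.IsHomogeneous d)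
    (A : Kˣ) (m : Fin 2 →₀ ℕ) :
    ‖coeff m F‖ ^ 2 * ‖(A : K)‖ ^ (2 * m 0) ≤
      normRatio d (diagGL A) F G * ‖(A : K)‖ ^ (d + 1) := by
  rw [normRatio_diagGL hd, ← norm_mul_coeff_conjForms_diagGL_fst (G := G)]
  gcongr
  exact norm_coeff_le_maxNorm_left (conjForms_isHomogeneous _ hF hG).1 m

lemma le_normRatio_diagGL_snd (hd : 1 ≤ d) (hF : F.IsHomogeneous d) (hG : G.IsHomogeneous d)
    (A : Kˣ) (m : Fin 2 →₀ ℕ) :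
    ‖coeff m G‖ ^ 2 * ‖(A : K)‖ ^ (2 * m 0 + 2) ≤
      normRatio d (diagGL A) F G * ‖(A : K)‖ ^ (d + 1) := by
  rw [normRatio_diagGL hd, ← norm_mul_coeff_conjForms_diagGL_snd (F := F)]
  gcongr
  exact norm_coeff_le_maxNorm_right (conjForms_isHomogeneous _ hF hG).2 m

lemma exists_normRatio_diagGL_eq (hd : 1 ≤ d) (A : Kˣ) :
    ∃ m : Fin 2 →₀ ℕ, m 0 + m 1 = d ∧
      (normRatio d (diagGL A) F G * ‖(A : K)‖ ^ (d + 1) =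
          ‖coeff m F‖ ^ 2 * ‖(A : K)‖ ^ (2 * m 0) ∨
        normRatio d (diagGL A) F G * ‖(A : K)‖ ^ (d + 1) =
          ‖coeff m G‖ ^ 2 * ‖(A : K)‖ ^ (2 * m 0 + 2)) := by
  obtain ⟨m, hm, h⟩ := exists_maxNorm_eq d (conjForms (diagGL A) F G).1 (conjForms (diagGL A) F G).2
  refine ⟨m, hm, ?_⟩
  rw [normRatio_diagGL hd, ← norm_mul_coeff_conjForms_diagGL_fst (G := G),
    ← norm_mul_coeff_conjForms_diagGL_snd (F := F)]
  exact h.imp (fun h => by rw [h]) (fun h => by rw [h])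

end DiagonalRatio

section Valuation

variable {K : Type} [NontriviallyNormedField K] [IsAlgClosed K]

lemma exists_norm_mem_Ioo {s : ℝ} (hs : s < 1) : ∃ A : Kˣ, s < ‖(A : K)‖ ∧ ‖(A : K)‖ < 1 := by
  obtain ⟨t, ht0, ht1⟩ := NormedField.exists_norm_lt_one K
  obtain ⟨n, hn⟩ := exists_pow_lt_of_lt_one ht0 (max_lt hs (by norm_num : (1 / 2 : ℝ) < 1))
  have h0 : (0 : ℝ) ≤ max s (1 / 2) := le_max_of_le_right (by norm_num)
  have hn0 : n ≠ 0 := by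
    rintro rfl
    rw [pow_zero] at hn
    linarith
  obtain ⟨A, hA⟩ := IsAlgClosed.exists_pow_nat_eq t (Nat.pos_of_ne_zero hn0)
  have hA0 : A ≠ 0 := by
    rintro rfl
    rw [zero_pow hn0] at hA
    rw [← hA, norm_zero] at ht0
    exact lt_irrefl _ ht0
  rw [← hA, norm_pow] at hn ht1
  refine ⟨Units.mk0 A hA0, ?_, ?_⟩
  · exact (le_max_left _ _).trans_lt (lt_of_pow_lt_pow_left₀ n (norm_nonneg _) hn)
  · exact lt_of_not_ge fun h => absurd ht1 (not_lt.2 (one_le_pow₀ h))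

end Valuation

section Semistability

variable {K : Type} [NontriviallyNormedField K] [IsUltrametricDist K] {d : ℕ}

lemma unstableAt_zero_one_reduction_iff {f g : MvPolynomial (Fin 2) (intRing K)} :
    UnstableAt d (MvPolynomial.map (resMap K) f) (MvPolynomial.map (resMap K) g) 0 1 ↔
      (∀ m : Fin 2 →₀ ℕ, 2 * m 0 < d + 2 → ‖((coeff m f : intRing K) : K)‖ < 1) ∧
        ∀ m : Fin 2 →₀ ℕ, 2 * m 0 < d → ‖((coeff m g : intRing K) : K)‖ < 1 := by
  rw [unstableAt_zero_one_iff]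
  simp only [coeff_map, ← resMap_eq_zero_iff]
  constructor
  · exact fun h => ⟨fun m hm => by_contra fun h1 => absurd (h.1 m h1) (by omega),
      fun m hm => by_contra fun h1 => absurd (h.2 m h1) (by omega)⟩
  · exact fun h => ⟨fun m hm => not_lt.1 fun h1 => hm (h.1 m h1),
      fun m hm => not_lt.1 fun h1 => hm (h.2 m h1)⟩

lemma coeff_intMap (f : MvPolynomial (Fin 2) (intRing K)) (m : Fin 2 →₀ ℕ) :
    coeff m (intMap K f) = ((coeff m f : intRing K) : K) := by
  rw [intMap, coeff_map]; rfl

lemma one_le_normRatio_diagGL (hd : 1 ≤ d) {f g : MvPolynomial (Fin 2) (intRing K)}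
    (hf : f.IsHomogeneous d) (hg : g.IsHomogeneous d)
    (h : ¬UnstableAt d (MvPolynomial.map (resMap K) f) (MvPolynomial.map (resMap K) g) 0 1)
    {A : Kˣ} (hA : ‖(A : K)‖ ≤ 1) : 1 ≤ normRatio d (diagGL A) (intMap K f) (intMap K g) := by
  have hF := (intMap_isHomogeneous_iff (K := K)).2 hf
  have hG := (intMap_isHomogeneous_iff (K := K)).2 hg
  have hA0 : 0 < ‖(A : K)‖ := norm_pos_iff.2 A.ne_zero
  have key : ∀ e : ℕ, e ≤ d + 1 →
      ‖(A : K)‖ ^ e ≤ normRatio d (diagGL A) (intMap K f) (intMap K g) * ‖(A : K)‖ ^ (d + 1) →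
      1 ≤ normRatio d (diagGL A) (intMap K f) (intMap K g) := fun e he h =>
    le_of_mul_le_mul_right
      ((one_mul _).trans_le ((pow_le_pow_of_le_one hA0.le hA he).trans h)) (pow_pos hA0 _)
  rw [unstableAt_zero_one_reduction_iff, not_and_or] at h
  push Not at h
  rcases h with ⟨m, hm, h1⟩ | ⟨m, hm, h1⟩
  · refine key (2 * m 0) (by omega) (le_trans ?_ (le_normRatio_diagGL_fst hd hF hG A m))
    rw [coeff_intMap]
    exact le_mul_of_one_le_left (by positivity) (one_le_pow₀ h1)
  · refine key (2 * m 0 + 2) (by omega) (le_trans ?_ (le_normRatio_diagGL_snd hd hF hG A m))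
    rw [coeff_intMap]
    exact le_mul_of_one_le_left (by positivity) (one_le_pow₀ h1)

lemma exists_normRatio_diagGL_lt_one [IsAlgClosed K] (hd : 1 ≤ d)
    {f g : MvPolynomial (Fin 2) (intRing K)}
    (h : UnstableAt d (MvPolynomial.map (resMap K) f) (MvPolynomial.map (resMap K) g) 0 1) :
    ∃ A : Kˣ, normRatio d (diagGL A) (intMap K f) (intMap K g) < 1 := by
  obtain ⟨h1, h2⟩ := unstableAt_zero_one_reduction_iff.1 h
  have hev : ∀ H : MvPolynomial (Fin 2) (intRing K), ∀ᶠ r : ℝ in nhds 1, ∀ m ∈ H.support,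
      ‖((coeff m H : intRing K) : K)‖ < 1 → ‖((coeff m H : intRing K) : K)‖ ^ 2 < r ^ (d + 1) := by
    intro H
    rw [Filter.eventually_all_finset]
    intro m _
    by_cases hm : ‖((coeff m H : intRing K) : K)‖ < 1
    · have hc : Filter.Tendsto (fun r : ℝ => r ^ (d + 1)) (nhds 1) (nhds 1) := by
        simpa using (continuous_pow (M := ℝ) (d + 1)).tendsto 1
      filter_upwards [hc.eventually_const_lt (pow_lt_one₀ (norm_nonneg _) hm two_ne_zero)] with r hr _
      exact hr
    · exact Filter.Eventually.of_forall fun r hr => absurd hr hm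
  obtain ⟨s, hs1, hs⟩ := exists_Ioc_subset_of_mem_nhds ((hev f).and (hev g)) ⟨0, zero_lt_one⟩
  obtain ⟨A, hA1, hA2⟩ := exists_norm_mem_Ioo (K := K) hs1
  have hA0 : 0 < ‖(A : K)‖ := norm_pos_iff.2 A.ne_zero
  obtain ⟨hf, hg⟩ := hs ⟨hA1, hA2.le⟩
  have hlt : ∀ H : MvPolynomial (Fin 2) (intRing K), (∀ m ∈ H.support,
      ‖((coeff m H : intRing K) : K)‖ < 1 → ‖((coeff m H : intRing K) : K)‖ ^ 2 < ‖(A : K)‖ ^ (d + 1)) → ∀ (m : Fin 2 →₀ ℕ)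
      (e : ℕ), (e < d + 2 → ‖((coeff m H : intRing K) : K)‖ < 1) →
        ‖((coeff m H : intRing K) : K)‖ ^ 2 * ‖(A : K)‖ ^ e < ‖(A : K)‖ ^ (d + 1) := by
    intro H hH m e he
    by_cases hm : m ∈ H.support
    · by_cases hed : e < d + 2
      · exact (mul_le_of_le_one_right (by positivity) (pow_le_one₀ hA0.le hA2.le)).trans_lt
          (hH m hm (he hed))
      · refine (mul_le_of_le_one_left (by positivity)
          (pow_le_one₀ (norm_nonneg _) (coeff m H).2)).trans_lt ?_
        exact pow_lt_pow_right_of_lt_one₀ hA0 hA2 (by omega)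
    · rw [notMem_support_iff.1 hm]
      simp
  refine ⟨A, lt_of_mul_lt_mul_right (a := ‖(A : K)‖ ^ (d + 1)) ?_ (by positivity)⟩
  rw [one_mul]
  obtain ⟨m, -, hm | hm⟩ := exists_normRatio_diagGL_eq (F := intMap K f) (G := intMap K g) hd A
  · rw [hm, coeff_intMap]
    exact hlt f hf m _ (h1 m)
  · rw [hm, coeff_intMap]
    exact hlt g hg m _ fun h => h2 m (by omega)

lemma exists_intGL_lift {a b : kk K} (h : ¬(a = 0 ∧ b = 0)) :
    ∃ U : GL (Fin 2) (intRing K), resMap K (U.val 0 1) = a ∧ resMap K (U.val 1 1) = b := by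
  obtain ⟨x, rfl⟩ := resMap_surjective a
  obtain ⟨y, rfl⟩ := resMap_surjective b
  by_cases hy : resMap K y = 0
  · have hx : IsUnit x := isUnit_intRing_iff.2 (resMap_ne_zero_iff.1 fun hx => h ⟨hx, hy⟩)
    refine ⟨Matrix.GeneralLinearGroup.mk'' !![0, x; 1, y] ?_, rfl, rfl⟩
    simpa [Matrix.det_fin_two] using hx
  · have hy : IsUnit y := isUnit_intRing_iff.2 (resMap_ne_zero_iff.1 hy)
    refine ⟨Matrix.GeneralLinearGroup.mk'' !![1, x; 0, y] ?_, rfl, rfl⟩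
    simpa [Matrix.det_fin_two] using hy

lemma unstableAt_reduction_conjForms (f g : MvPolynomial (Fin 2) (intRing K))
    (U : GL (Fin 2) (intRing K)) :
    UnstableAt d (MvPolynomial.map (resMap K) (conjForms U f g).1)
        (MvPolynomial.map (resMap K) (conjForms U f g).2) 0 1 ↔
      UnstableAt d (MvPolynomial.map (resMap K) f) (MvPolynomial.map (resMap K) g)
        (resMap K (U.val 0 1)) (resMap K (U.val 1 1)) := by
  have h := map_conjForms (resMap K) U f g
  obtain ⟨h1, h2⟩ := Prod.ext_iff.1 h
  dsimp only at h1 h2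
  rw [← h1, ← h2, unstableAt_conjForms_iff, mul_zero, zero_add, mul_one, mul_zero, zero_add,
    mul_one]
  rfl

lemma semistable_iff_forall_one_le_normRatio [IsAlgClosed K] (hd : 1 ≤ d)
    {F G : MvPolynomial (Fin 2) K} (hF : F.IsHomogeneous d) (hG : G.IsHomogeneous d)
    (hn : Normalized K F G) :
    Semistable K d F G ↔ ∀ N : GL (Fin 2) K, 1 ≤ normRatio d N F G := by
  obtain ⟨f, rfl⟩ := exists_intMap_eq hn.1
  obtain ⟨g, rfl⟩ := exists_intMap_eq hn.2.1
  have hf := (intMap_isHomogeneous_iff (K := K)).1 hF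
  have hg := (intMap_isHomogeneous_iff (K := K)).1 hG
  have hconj : ∀ U : GL (Fin 2) (intRing K), conjForms (intGL U) (intMap K f) (intMap K g) =
      (intMap K (conjForms U f g).1, intMap K (conjForms U f g).2) :=
    fun U => map_conjForms _ U f g
  change SemistablePair d _ _ ↔ _
  rw [redPoly_intMap, redPoly_intMap, semistablePair_iff (hf.map _) (hg.map _)]
  constructor
  · intro h N
    obtain ⟨U, V, A, c, hA, rfl⟩ := hasCartan N
    rw [normRatio_mul_intGL hF hG, normRatio_intGL_mul, hconj]
    have hfU := conjForms_isHomogeneous U hf hg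
    rw [normRatio_mul_scalar hd ((intMap_isHomogeneous_iff (K := K)).2 hfU.1)
      ((intMap_isHomogeneous_iff (K := K)).2 hfU.2)]
    refine one_le_normRatio_diagGL hd hfU.1 hfU.2 ?_ hA
    rw [unstableAt_reduction_conjForms]
    refine h _ _ fun h0 => ?_
    have hdet := ((Matrix.isUnit_iff_isUnit_det _).1 U.isUnit).map (resMap K)
    rw [Matrix.det_fin_two, map_sub, map_mul, map_mul, h0.1, h0.2] at hdet
    simp at hdet
  · intro h a b hab hu
    obtain ⟨U, rfl, rfl⟩ := exists_intGL_lift hab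
    rw [← unstableAt_reduction_conjForms] at hu
    obtain ⟨A, hA⟩ := exists_normRatio_diagGL_lt_one hd hu
    have := h (intGL U * diagGL A)
    rw [normRatio_intGL_mul, hconj] at this
    exact absurd hA (not_lt.2 this)

end Semistability

section GaussNorm

variable {K : Type} [NontriviallyNormedField K]

/-- The Gauss norm of `h(A z + B)`. -/
def gaussComp (h : Polynomial K) (A B : K) : ℝ :=
  (h.comp (Polynomial.C A * Polynomial.X + Polynomial.C B)).gaussNorm
    (NormedField.toAbsoluteValue K) 1

lemma gaussNorm_C_mul_X_add_C (A B : K) :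
    (Polynomial.C A * Polynomial.X + Polynomial.C B).gaussNorm (NormedField.toAbsoluteValue K) 1 =
      max ‖A‖ ‖B‖ := by
  set h := Polynomial.C A * Polynomial.X + Polynomial.C B with hh
  have h0 : h.coeff 0 = B := by simp [hh]
  have h1 : h.coeff 1 = A := by simp [hh]
  refine le_antisymm ?_ (max_le ?_ ?_)
  · obtain ⟨i, hi⟩ := h.exists_eq_gaussNorm (NormedField.toAbsoluteValue K) 1
    rw [hi, one_pow, mul_one]
    rcases i with _ | _ | i
    · rw [h0]; exact le_max_right _ _
    · rw [h1]; exact le_max_left _ _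
    · have : h.coeff (i + 2) = 0 := Polynomial.coeff_eq_zero_of_natDegree_lt
        (Polynomial.natDegree_linear_le.trans_lt (by omega))
      rw [this, map_zero]
      exact le_max_of_le_left (norm_nonneg _)
  · simpa [h1] using! h.le_gaussNorm (NormedField.toAbsoluteValue K) zero_le_one 1
  · simpa [h0] using! h.le_gaussNorm (NormedField.toAbsoluteValue K) zero_le_one 0

variable [IsUltrametricDist K]

lemma gaussNorm_one_mul (p q : Polynomial K) :
    (p * q).gaussNorm (NormedField.toAbsoluteValue K) 1 =
      p.gaussNorm (NormedField.toAbsoluteValue K) 1 *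
        q.gaussNorm (NormedField.toAbsoluteValue K) 1 :=
  Polynomial.gaussNorm_mul (fun x y => IsUltrametricDist.norm_add_le_max x y) zero_lt_one p q

lemma gaussComp_mul (p q : Polynomial K) (A B : K) :
    gaussComp (p * q) A B = gaussComp p A B * gaussComp q A B := by
  rw [gaussComp, Polynomial.mul_comp, gaussNorm_one_mul]; rfl

lemma gaussComp_eq [IsAlgClosed K] (h : Polynomial K) (A B : K) :
    gaussComp h A B = ‖h.leadingCoeff‖ * (h.roots.map fun σ => max ‖A‖ ‖B - σ‖).prod := by
  have hprod : ∀ s : Multiset K, gaussComp (s.map fun σ => Polynomial.X - Polynomial.C σ).prod A B =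
      (s.map fun σ => max ‖A‖ ‖B - σ‖).prod := by
    intro s
    induction s using Multiset.induction with
    | empty => simp [gaussComp, ← Polynomial.C_1, -map_one]
    | cons a s ih =>
      rw [Multiset.map_cons, Multiset.prod_cons, gaussComp_mul, ih, Multiset.map_cons,
        Multiset.prod_cons, ← gaussNorm_C_mul_X_add_C, gaussComp]
      simp [add_sub_assoc]
  conv_lhs => rw [(IsAlgClosed.splits h).eq_prod_roots]
  rw [gaussComp_mul, hprod, gaussComp, Polynomial.C_comp, Polynomial.gaussNorm_C]
  rfl

lemma gaussComp_congr [IsAlgClosed K] {h : Polynomial K} {A B A' B' : K}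
    (H : ∀ σ ∈ h.roots, max ‖A‖ ‖B - σ‖ = max ‖A'‖ ‖B' - σ‖) :
    gaussComp h A B = gaussComp h A' B' := by
  rw [gaussComp_eq, gaussComp_eq, Multiset.map_congr rfl H]

end GaussNorm

section Affine

variable {K : Type} [NontriviallyNormedField K] {d : ℕ} {F G : MvPolynomial (Fin 2) K}

/-- The matrix of `z ↦ A / z + B`. -/
def affGL (A : Kˣ) (B : K) : GL (Fin 2) K where
  val := !![B, A; 1, 0]
  inv := !![0, 1; (A : K)⁻¹, -((A : K)⁻¹ * B)]
  val_inv := by ext i j; fin_cases i <;> fin_cases j <;> simp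
  inv_val := by ext i j; fin_cases i <;> fin_cases j <;> simp

lemma det_affGL (A : Kˣ) (B : K) : (affGL A B).val.det = -A := by
  simp [affGL, Matrix.det_fin_two]

/-- The dehomogenization `X 1 = 1`. -/
def dehomOne : MvPolynomial (Fin 2) K →ₐ[K] Polynomial K := aeval ![Polynomial.X, 1]

lemma dehom_linSubst_affGL (A : Kˣ) (B : K) (H : MvPolynomial (Fin 2) K) :
    dehom (linSubst (affGL A B).val H) =
      (dehomOne H).comp (Polynomial.C (A : K) * Polynomial.X + Polynomial.C B) := by
  have h : (dehom (k := K)).comp (linSubst (affGL A B).val) =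
      (Polynomial.aeval (Polynomial.C (A : K) * Polynomial.X + Polynomial.C B)).comp dehomOne := by
    ext i : 1
    fin_cases i <;> simp [dehom, dehomOne, affGL, linSubst, add_comm]
  exact DFunLike.congr_fun h H

lemma max_gaussNorm_dehom_eq (hF : F.IsHomogeneous d) (hG : G.IsHomogeneous d) :
    maxNorm K d F G = max ((dehom F).gaussNorm (NormedField.toAbsoluteValue K) 1)
      ((dehom G).gaussNorm (NormedField.toAbsoluteValue K) 1) := by
  have hle : ∀ H : MvPolynomial (Fin 2) K, H.IsHomogeneous d → ∀ m,
      ‖coeff m H‖ ≤ (dehom H).gaussNorm (NormedField.toAbsoluteValue K) 1 := by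
    intro H hH m
    by_cases hm : m 0 + m 1 = d
    · have h := (dehom H).le_gaussNorm (NormedField.toAbsoluteValue K) zero_le_one (m 1)
      rw [coeff_dehom hH, if_pos (by omega), one_pow, mul_one] at h
      rwa [finsupp_fin_two_eq m, show m 0 = d - m 1 by omega]
    · rw [hH.coeff_eq_zero fun h => hm (by rw [← h, Finsupp.degree_eq_sum, Fin.sum_univ_two]),
        norm_zero]
      exact Polynomial.gaussNorm_nonneg _ _ zero_le_one
  have hge : ∀ H : MvPolynomial (Fin 2) K, H.IsHomogeneous d →
      ∃ m, (dehom H).gaussNorm (NormedField.toAbsoluteValue K) 1 = ‖coeff m H‖ := by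
    intro H hH
    obtain ⟨i, hi⟩ := (dehom H).exists_eq_gaussNorm (NormedField.toAbsoluteValue K) 1
    refine ⟨Finsupp.single 0 (d - i) + Finsupp.single 1 i, ?_⟩
    rw [hi, one_pow, mul_one, coeff_dehom hH]
    split_ifs with hid
    · rfl
    · rw [hH.coeff_eq_zero, norm_zero, map_zero]
      rw [Finsupp.degree_eq_sum, Fin.sum_univ_two]
      simp
      omega
  refine le_antisymm (maxNorm_le (fun m => le_max_of_le_left (hle F hF m))
    fun m => le_max_of_le_right (hle G hG m)) (max_le ?_ ?_)
  · obtain ⟨m, hm⟩ := hge F hF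
    exact hm ▸ norm_coeff_le_maxNorm_left hF m
  · obtain ⟨m, hm⟩ := hge G hG
    exact hm ▸ norm_coeff_le_maxNorm_right hG m

variable [IsUltrametricDist K]

lemma max_gaussNorm_sub_eq (p q : Polynomial K) :
    max (p.gaussNorm (NormedField.toAbsoluteValue K) 1)
        (q.gaussNorm (NormedField.toAbsoluteValue K) 1) =
      max ((p - q).gaussNorm (NormedField.toAbsoluteValue K) 1)
        (q.gaussNorm (NormedField.toAbsoluteValue K) 1) := by
  set N : Polynomial K → ℝ := fun p => p.gaussNorm (NormedField.toAbsoluteValue K) 1 with hN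
  have hadd : ∀ p q, N (p + q) ≤ max (N p) (N q) :=
    Polynomial.isNonarchimedean_gaussNorm (NormedField.toAbsoluteValue K)
      (fun x y => IsUltrametricDist.norm_add_le_max x y) zero_le_one
  have hneg : ∀ q, N (-q) = N q := fun q => by
    have h : -q = Polynomial.C (-1) * q := by simp
    rw [h, hN]
    dsimp only
    rw [gaussNorm_one_mul, Polynomial.gaussNorm_C, map_neg_eq_map, map_one, one_mul]
  refine le_antisymm (max_le ?_ (le_max_right _ _)) (max_le ?_ (le_max_right _ _))
  · simpa using hadd (p - q) q
  · simpa [sub_eq_add_neg, hneg] using hadd p (-q)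

lemma maxNorm_conjForms_affGL (hF : F.IsHomogeneous d) (hG : G.IsHomogeneous d) (A : Kˣ) (B : K) :
    maxNorm K d (conjForms (affGL A B) F G).1 (conjForms (affGL A B) F G).2 =
      max (gaussComp (dehomOne G) (A : K) B)
        (gaussComp (dehomOne F - Polynomial.X * dehomOne G) (A : K) B / ‖(A : K)‖) := by
  obtain ⟨h1, h2⟩ := conjForms_isHomogeneous (affGL A B) hF hG
  rw [max_gaussNorm_dehom_eq h1 h2]
  have h : (affGL A B)⁻¹.val = !![0, 1; (A : K)⁻¹, -((A : K)⁻¹ * B)] := rfl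
  have e1 : dehom (conjForms (affGL A B) F G).1 =
      (dehomOne G).comp (Polynomial.C (A : K) * Polynomial.X + Polynomial.C B) := by
    rw [← dehom_linSubst_affGL, conjForms, h]; simp
  have e2 : Polynomial.C (A : K) * dehom (conjForms (affGL A B) F G).2 -
        Polynomial.C (A : K) * Polynomial.X * dehom (conjForms (affGL A B) F G).1 =
      (dehomOne F - Polynomial.X * dehomOne G).comp
        (Polynomial.C (A : K) * Polynomial.X + Polynomial.C B) := by
    have hc : Polynomial.C (A : K) * Polynomial.C (A : K)⁻¹ = 1 := by
      rw [← Polynomial.C_mul, mul_inv_cancel₀ A.ne_zero, Polynomial.C_1]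
    rw [e1, Polynomial.sub_comp, Polynomial.mul_comp, Polynomial.X_comp, ← dehom_linSubst_affGL,
      ← dehom_linSubst_affGL, conjForms, h]
    have hC : ∀ c : K, dehom (C c) = Polynomial.C c := fun c => by simp [dehom]
    simp [hC]
    linear_combination (dehom (linSubst (affGL A B).val F) -
      Polynomial.C B * dehom (linSubst (affGL A B).val G)) * hc
  have hA : 0 < ‖(A : K)‖ := norm_pos_iff.2 A.ne_zero
  have hX : (Polynomial.X : Polynomial K).gaussNorm (NormedField.toAbsoluteValue K) 1 = 1 := by
    simpa using gaussNorm_C_mul_X_add_C (1 : K) 0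
  have hm := max_gaussNorm_sub_eq (Polynomial.C (A : K) * dehom (conjForms (affGL A B) F G).2)
    (Polynomial.C (A : K) * Polynomial.X * dehom (conjForms (affGL A B) F G).1)
  rw [e2, gaussNorm_one_mul, gaussNorm_one_mul, gaussNorm_one_mul, Polynomial.gaussNorm_C, hX,
    mul_one, e1] at hm
  change max (‖(A : K)‖ * _) (‖(A : K)‖ * _) = max (gaussComp _ _ _) (‖(A : K)‖ * _) at hm
  rw [e1, max_comm, ← mul_right_inj' hA.ne', mul_max_of_nonneg _ _ hA.le,
    mul_max_of_nonneg _ _ hA.le, mul_div_cancel₀ _ hA.ne', hm, max_comm]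
  rfl

end Affine

section Linear

/-- A maximum of finitely many affine functions with rational slopes of both signs and values in a
`ℚ`-subspace attains its minimum in that subspace. -/
lemma exists_minimizer_of_affine {ι : Type*} (T : Finset ι) (a : ι → ℚ) (c : ι → ℝ)
    (V : Submodule ℚ ℝ) (hc : ∀ l ∈ T, c l ∈ V) (hneg : ∃ l ∈ T, a l < 0) (hpos : ∃ l ∈ T, 0 < a l) :
    ∃ s ∈ V, ∀ t : ℝ, ∀ l ∈ T, ∃ l' ∈ T, c l + a l * s ≤ c l' + a l' * t := by
  classical
  let w : ι × ι → ℝ := fun p =>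
    (a p.2 / (a p.2 - a p.1) : ℚ) • c p.1 + (-a p.1 / (a p.2 - a p.1) : ℚ) • c p.2
  let N := T.filter fun l => a l < 0
  let P := T.filter fun l => 0 < a l
  let Z := T.filter fun l => a l = 0
  have hN : ∀ l, l ∈ N ↔ l ∈ T ∧ a l < 0 := fun l => Finset.mem_filter
  have hP : ∀ l, l ∈ P ↔ l ∈ T ∧ 0 < a l := fun l => Finset.mem_filter
  have hZ : ∀ l, l ∈ Z ↔ l ∈ T ∧ a l = 0 := fun l => Finset.mem_filter
  obtain ⟨n₀, hn₀, hn₀'⟩ := hneg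
  obtain ⟨p₀, hp₀, hp₀'⟩ := hpos
  have hne : ((N ×ˢ P).image w ∪ Z.image c).Nonempty :=
    ⟨w (n₀, p₀), Finset.mem_union_left _ (Finset.mem_image_of_mem _
      (Finset.mk_mem_product ((hN _).2 ⟨hn₀, hn₀'⟩) ((hP _).2 ⟨hp₀, hp₀'⟩)))⟩
  obtain ⟨v, hv, hmax⟩ := Finset.exists_max_image _ id hne
  have hw : ∀ n ∈ N, ∀ p ∈ P, w (n, p) ≤ v := fun n hn p hp => hmax _
    (Finset.mem_union_left _ (Finset.mem_image_of_mem _ (Finset.mk_mem_product hn hp)))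
  have hz : ∀ l ∈ Z, c l ≤ v := fun l hl => hmax _
    (Finset.mem_union_right _ (Finset.mem_image_of_mem _ hl))
  have hvV : v ∈ V := by
    rcases Finset.mem_union.1 hv with h | h
    · obtain ⟨⟨n, p⟩, hnp, rfl⟩ := Finset.mem_image.1 h
      obtain ⟨h1, h2⟩ := Finset.mem_product.1 hnp
      exact V.add_mem (V.smul_mem _ (hc _ ((hN _).1 h1).1)) (V.smul_mem _ (hc _ ((hP _).1 h2).1))
    · obtain ⟨l, hl, rfl⟩ := Finset.mem_image.1 h
      exact hc _ ((hZ _).1 hl).1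
  have hlow : ∀ t : ℝ, ∃ l' ∈ T, v ≤ c l' + a l' * t := by
    intro t
    rcases Finset.mem_union.1 hv with h | h
    · obtain ⟨⟨n, p⟩, hnp, rfl⟩ := Finset.mem_image.1 h
      obtain ⟨h1, h2⟩ := Finset.mem_product.1 hnp
      obtain ⟨h1, h1'⟩ := (hN _).1 h1
      obtain ⟨h2, h2'⟩ := (hP _).1 h2
      dsimp only at h1 h2 h1' h2'
      by_contra! hcon
      have e1 := hcon n h1
      have e2 := hcon p h2
      have h1r : (a n : ℝ) < 0 := by exact_mod_cast h1'
      have h2r : (0 : ℝ) < a p := by exact_mod_cast h2'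
      have hd : (0 : ℝ) < a p - a n := by linarith
      have hwe : w (n, p) * (a p - a n) = a p * c n - a n * c p := by
        simp only [w, Rat.smul_def]
        push_cast
        field_simp
        ring
      have e3 := mul_lt_mul_of_pos_left e1 h2r
      have e4 := mul_lt_mul_of_pos_left e2 (neg_pos.2 h1r)
      nlinarith
    · obtain ⟨l, hl, rfl⟩ := Finset.mem_image.1 h
      obtain ⟨h1, h2⟩ := (hZ _).1 hl
      exact ⟨l, h1, by rw [h2]; simp⟩
  obtain ⟨n, hn, hnmax⟩ := Finset.exists_max_image N (fun l => (1 / a l : ℚ) • (v - c l))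
    ⟨n₀, (hN _).2 ⟨hn₀, hn₀'⟩⟩
  obtain ⟨hnT, hna⟩ := (hN n).1 hn
  have hnr : (a n : ℝ) < 0 := by exact_mod_cast hna
  set s : ℝ := (1 / a n : ℚ) • (v - c n) with hs
  have hsn : a n * s = v - c n := by
    rw [hs, Rat.smul_def]
    push_cast
    rw [one_div, mul_inv_cancel_left₀ hnr.ne]
  refine ⟨s, V.smul_mem _ (V.sub_mem hvV (hc _ hnT)), fun t l hl => ?_⟩
  obtain ⟨l', hl', h⟩ := hlow t
  refine ⟨l', hl', le_trans ?_ h⟩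
  rcases lt_trichotomy (a l) 0 with hal | hal | hal
  · have hlr : (a l : ℝ) < 0 := by exact_mod_cast hal
    have h1 := hnmax l ((hN _).2 ⟨hl, hal⟩)
    have h2 : a l * ((1 / a l : ℚ) • (v - c l)) = v - c l := by
      rw [Rat.smul_def]
      push_cast
      rw [one_div, mul_inv_cancel_left₀ hlr.ne]
    have h3 := mul_le_mul_of_nonpos_left h1 hlr.le
    linarith
  · have := hz l ((hZ _).2 ⟨hl, hal⟩)
    rw [hal]
    simpa using this
  · have hlr : (0 : ℝ) < a l := by exact_mod_cast hal
    have h1 := hw n hn l ((hP _).2 ⟨hl, hal⟩)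
    have hd : (0 : ℝ) < a l - a n := by linarith
    have hwe : w (n, l) * (a l - a n) = a l * c n - a n * c l := by
      simp only [w, Rat.smul_def]
      push_cast
      field_simp
      ring
    have h2 := mul_le_mul_of_nonneg_right h1 hd.le
    rw [hwe] at h2
    have h3 : (-(a n : ℝ)) * (c l + a l * s) ≤ -a n * v := by
      have : a l * (a n * s) = a l * (v - c n) := by rw [hsn]
      nlinarith
    exact le_of_mul_le_mul_left h3 (by linarith)

end Linear

section Minimizer

variable {K : Type} [NontriviallyNormedField K] {d : ℕ} {F G : MvPolynomial (Fin 2) K}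

/-- The logarithmic value group of an algebraically closed normed field, as a `ℚ`-vector space. -/
def logValueGroup (K : Type) [NontriviallyNormedField K] [IsAlgClosed K] : Submodule ℚ ℝ where
  carrier := {x | ∃ A : Kˣ, x = Real.log ‖(A : K)‖}
  zero_mem' := ⟨1, by simp⟩
  add_mem' := by
    rintro _ _ ⟨A, rfl⟩ ⟨B, rfl⟩
    refine ⟨A * B, ?_⟩
    rw [Units.val_mul, norm_mul, Real.log_mul (norm_ne_zero_iff.2 A.ne_zero)
      (norm_ne_zero_iff.2 B.ne_zero)]
  smul_mem' := by
    rintro q _ ⟨A, rfl⟩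
    obtain ⟨x, hx⟩ := IsAlgClosed.exists_pow_nat_eq (A : K) q.den_pos
    have hx0 : x ≠ 0 := by
      rintro rfl
      rw [zero_pow q.den_ne_zero] at hx
      exact A.ne_zero hx.symm
    refine ⟨Units.mk0 x hx0 ^ q.num, ?_⟩
    rw [Units.val_zpow_eq_zpow_val, Units.val_mk0, norm_zpow, Real.log_zpow, ← hx, norm_pow,
      Real.log_pow, Rat.smul_def, ← mul_assoc]
    congr 1
    exact_mod_cast Rat.mul_den_eq_num q

lemma normRatio_pos (M : GL (Fin 2) K) (hF : F.IsHomogeneous d) (hG : G.IsHomogeneous d)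
    (h : ¬(F = 0 ∧ G = 0)) : 0 < normRatio d M F G := by
  obtain ⟨h1, h2⟩ := conjForms_isHomogeneous M hF hG
  refine div_pos (pow_pos (maxNorm_pos h1 h2 fun h0 => h ?_) 2) (pow_pos (norm_det_pos M) _)
  have h3 := conjForms_mul M M⁻¹ F G
  rw [mul_inv_cancel, conjForms_one, h0.1, h0.2, Prod.mk.injEq] at h3
  exact ⟨by simpa [conjForms] using h3.1, by simpa [conjForms] using h3.2⟩

lemma NoCommonZero.not_both_zero (h : NoCommonZero F G) : ¬(F = 0 ∧ G = 0) := by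
  rintro ⟨rfl, rfl⟩
  exact one_ne_zero (h 1 0 (map_zero _) (map_zero _)).1

lemma exists_diagGL_minimizer [IsAlgClosed K] (hd : 2 ≤ d) (hF : F.IsHomogeneous d)
    (hG : G.IsHomogeneous d) (h : NoCommonZero F G) :
    ∃ A : Kˣ, ∀ A' : Kˣ, normRatio d (diagGL A) F G ≤ normRatio d (diagGL A') F G := by
  classical
  let H : Bool → MvPolynomial (Fin 2) K := fun b => cond b G F
  let e : Bool → ℕ := fun b => cond b 2 0
  have hH : ∀ b, (H b).IsHomogeneous d := by rintro (_ | _) <;> assumption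
  have hle : ∀ (A : Kˣ) b m, ‖coeff m (H b)‖ ^ 2 * ‖(A : K)‖ ^ (2 * m 0 + e b) ≤
      normRatio d (diagGL A) F G * ‖(A : K)‖ ^ (d + 1) := by
    rintro A (_ | _) m
    · exact le_normRatio_diagGL_fst (by omega) hF hG A m
    · exact le_normRatio_diagGL_snd (by omega) hF hG A m
  have heq : ∀ A : Kˣ, ∃ b m, normRatio d (diagGL A) F G * ‖(A : K)‖ ^ (d + 1) =
      ‖coeff m (H b)‖ ^ 2 * ‖(A : K)‖ ^ (2 * m 0 + e b) := by
    intro A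
    obtain ⟨m, -, h1 | h1⟩ := exists_normRatio_diagGL_eq (F := F) (G := G) (one_le_two.trans hd) A
    exacts [⟨false, m, h1⟩, ⟨true, m, h1⟩]
  have hex : ∀ i : Fin 2, ∃ b m, m i = 0 ∧ coeff m (H b) ≠ 0 := by
    intro i
    by_contra! hcon
    have hev : ∀ b, eval (Pi.single (1 - i) 1) (H b) = 0 := by
      intro b
      rw [eval_eq']
      refine Finset.sum_eq_zero fun m _ => ?_
      by_cases hm : m i = 0
      · rw [hcon b m hm, zero_mul]
      · refine mul_eq_zero_of_right _ (Finset.prod_eq_zero (Finset.mem_univ i) ?_)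
        rw [Pi.single_eq_of_ne (by fin_cases i <;> simp), zero_pow hm]
    fin_cases i
    · have hv : (Pi.single (1 - 0) 1 : Fin 2 → K) = ![0, 1] := by
        ext j; fin_cases j <;> simp
      exact one_ne_zero (h 0 1 (hv ▸ hev false) (hv ▸ hev true)).2
    · have hv : (Pi.single (1 - 1) 1 : Fin 2 → K) = ![1, 0] := by
        ext j; fin_cases j <;> simp
      exact one_ne_zero (h 1 0 (hv ▸ hev false) (hv ▸ hev true)).1
  let T : Finset (Bool × (Fin 2 →₀ ℕ)) := Finset.univ.biUnion fun b =>
    (H b).support.image fun m => (b, m)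
  have hT : ∀ b m, (b, m) ∈ T ↔ coeff m (H b) ≠ 0 := by simp [T]
  let a : Bool × (Fin 2 →₀ ℕ) → ℚ := fun l => 2 * l.2 0 + e l.1 - (d + 1)
  let c : Bool × (Fin 2 →₀ ℕ) → ℝ := fun l => 2 * Real.log ‖coeff l.2 (H l.1)‖
  have hlog : ∀ (A : Kˣ) b m, (b, m) ∈ T → c (b, m) + a (b, m) * Real.log ‖(A : K)‖ =
      Real.log (‖coeff m (H b)‖ ^ 2 * ‖(A : K)‖ ^ (2 * m 0 + e b)) -
        Real.log (‖(A : K)‖ ^ (d + 1)) := by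
    intro A b m hm
    have h1 : ‖coeff m (H b)‖ ≠ 0 := norm_ne_zero_iff.2 ((hT b m).1 hm)
    have h2 : ‖(A : K)‖ ≠ 0 := norm_ne_zero_iff.2 A.ne_zero
    rw [Real.log_mul (pow_ne_zero _ h1) (pow_ne_zero _ h2), Real.log_pow, Real.log_pow,
      Real.log_pow]
    simp only [a, c]
    push_cast
    ring
  have hnr : ∀ A : Kˣ, 0 < normRatio d (diagGL A) F G := fun A =>
    normRatio_pos _ hF hG h.not_both_zero
  have hpw : ∀ A : Kˣ, 0 < ‖(A : K)‖ ^ (d + 1) := fun A =>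
    pow_pos (norm_pos_iff.2 A.ne_zero) _
  have hmul : ∀ A : Kˣ, Real.log (normRatio d (diagGL A) F G * ‖(A : K)‖ ^ (d + 1)) -
      Real.log (‖(A : K)‖ ^ (d + 1)) = Real.log (normRatio d (diagGL A) F G) := fun A => by
    rw [Real.log_mul (hnr A).ne' (hpw A).ne', add_sub_cancel_right]
  have hc : ∀ l ∈ T, c l ∈ logValueGroup K := by
    rintro ⟨b, m⟩ hm
    exact ⟨Units.mk0 _ (pow_ne_zero 2 ((hT b m).1 hm)), by simp [c]⟩
  have hneg : ∃ l ∈ T, a l < 0 := by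
    obtain ⟨b, m, h0, hm⟩ := hex 0
    refine ⟨(b, m), (hT b m).2 hm, ?_⟩
    have : e b < d + 1 := by rcases b with _ | _ <;> simp only [e, cond] <;> omega
    have : (e b : ℚ) < d + 1 := by exact_mod_cast this
    simp only [a, h0]
    push_cast
    linarith
  have hpos : ∃ l ∈ T, 0 < a l := by
    obtain ⟨b, m, h0, hm⟩ := hex 1
    refine ⟨(b, m), (hT b m).2 hm, ?_⟩
    have h1 := (hH b).exponents_add hm
    have : d + 1 < 2 * m 0 + e b := by omega
    have : (d + 1 : ℚ) < 2 * m 0 + e b := by exact_mod_cast this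
    simp only [a]
    linarith
  obtain ⟨s, ⟨A, rfl⟩, hs⟩ := exists_minimizer_of_affine T a c (logValueGroup K) hc hneg hpos
  refine ⟨A, fun A' => ?_⟩
  obtain ⟨b, m, h1⟩ := heq A
  have hm : (b, m) ∈ T := by
    rw [hT]
    intro h0
    rw [h0, norm_zero, zero_pow two_ne_zero, zero_mul] at h1
    exact (mul_pos (hnr A) (hpw A)).ne' h1
  obtain ⟨⟨b', m'⟩, hm', h2⟩ := hs (Real.log ‖(A' : K)‖) _ hm
  rw [hlog A b m hm, hlog A' b' m' hm', ← h1, hmul] at h2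
  rw [← Real.log_le_log_iff (hnr A) (hnr A'), ← hmul A']
  refine h2.trans (sub_le_sub_right (Real.log_le_log ?_ (hle A' b' m')) _)
  exact mul_pos (pow_pos (norm_pos_iff.2 ((hT _ _).1 hm')) _)
    (pow_pos (norm_pos_iff.2 A'.ne_zero) _)

variable [IsUltrametricDist K]

lemma exists_normRatio_eq_affGL (hd : 1 ≤ d) (hF : F.IsHomogeneous d) (hG : G.IsHomogeneous d)
    (N : GL (Fin 2) K) : ∃ (A : Kˣ) (B : K), normRatio d N F G = normRatio d (affGL A B) F G := by
  have key : ∀ N : GL (Fin 2) K, ‖N.val 1 1‖ ≤ ‖N.val 1 0‖ →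
      ∃ (A : Kˣ) (B : K), normRatio d N F G = normRatio d (affGL A B) F G := by
    intro N hN
    have hdet : N.val 0 0 * N.val 1 1 - N.val 0 1 * N.val 1 0 ≠ 0 := by
      rw [← det_fin_two]
      exact norm_ne_zero_iff.1 (norm_det_pos N).ne'
    have hs : N.val 1 0 ≠ 0 := by
      intro h0
      rw [h0, norm_zero, norm_le_zero_iff] at hN
      rw [h0, hN] at hdet
      simp at hdet
    have hx : ‖N.val 1 1 / N.val 1 0‖ ≤ 1 := by
      rw [norm_div]
      exact div_le_one_of_le₀ hN (norm_nonneg _)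
    have hA : (N.val 0 1 * N.val 1 0 - N.val 0 0 * N.val 1 1) / N.val 1 0 ^ 2 ≠ 0 :=
      div_ne_zero (fun h0 => hdet (by linear_combination -h0)) (pow_ne_zero _ hs)
    refine ⟨Units.mk0 _ hA, N.val 0 0 / N.val 1 0, ?_⟩
    have hNeq : N = affGL (Units.mk0 _ hA) (N.val 0 0 / N.val 1 0) * scalarGL (Units.mk0 _ hs) *
        intGL (upperGL ⟨N.val 1 1 / N.val 1 0, hx⟩) := by
      ext i j
      fin_cases i <;> fin_cases j <;>
        simp [affGL, upperGL, Matrix.GeneralLinearGroup.coe_scalar, Matrix.mul_apply,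
          Fin.sum_univ_two]
      all_goals field_simp
      ring
    conv_lhs => rw [hNeq]
    rw [normRatio_mul_intGL hF hG, normRatio_mul_scalar hd hF hG]
  rcases le_total ‖N.val 1 1‖ ‖N.val 1 0‖ with h | h
  · exact key N h
  · rw [← normRatio_mul_intGL hF hG N (swapGL _)]
    refine key _ ?_
    simpa [swapGL, Matrix.mul_apply, Fin.sum_univ_two] using h

lemma exists_affGL_minimizer [IsAlgClosed K] (hd : 2 ≤ d) (hF : F.IsHomogeneous d)
    (hG : G.IsHomogeneous d) (h : NoCommonZero F G) (B : K) :
    ∃ A : Kˣ, ∀ A' : Kˣ, normRatio d (affGL A B) F G ≤ normRatio d (affGL A' B) F G := by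
  have hB : ∀ A : Kˣ, normRatio d (affGL A B) F G = normRatio d (diagGL A)
      (conjForms (upperGL B) F G).1 (conjForms (upperGL B) F G).2 := by
    intro A
    have h1 : affGL A B = upperGL B * diagGL A * intGL (swapGL _) := by
      ext i j
      fin_cases i <;> fin_cases j <;>
        simp [affGL, upperGL, diagGL, swapGL, Matrix.mul_apply, Fin.sum_univ_two]
    have h2 : (upperGL B).val.det = 1 := by simp [upperGL, det_fin_two]
    rw [h1, normRatio_mul_intGL hF hG, normRatio_mul, h2, norm_one, one_pow, div_one]
  obtain ⟨h1, h2⟩ := conjForms_isHomogeneous (upperGL B) hF hG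
  obtain ⟨A, hA⟩ := exists_diagGL_minimizer hd h1 h2 (h.conjForms _)
  exact ⟨A, fun A' => by rw [hB, hB]; exact hA A'⟩

set_option maxHeartbeats 1000000 in
lemma exists_normRatio_affGL_le [IsAlgClosed K] (hF : F.IsHomogeneous d)
    (hG : G.IsHomogeneous d) :
    ∃ S : Finset K, S.Nonempty ∧ ∀ (A : Kˣ) (B : K), ∃ (A' : Kˣ), ∃ ρ ∈ S,
      normRatio d (affGL A' ρ) F G ≤ normRatio d (affGL A B) F G := by
  classical
  obtain ⟨p, hp⟩ : ∃ p, p = dehomOne F - Polynomial.X * dehomOne G := ⟨_, rfl⟩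
  obtain ⟨S, hS, hSg, hSp⟩ : ∃ S : Finset K, S.Nonempty ∧ (∀ σ ∈ (dehomOne G).roots, σ ∈ S) ∧
      ∀ σ ∈ p.roots, σ ∈ S :=
    ⟨insert 0 ((dehomOne G).roots.toFinset ∪ p.roots.toFinset), Finset.insert_nonempty _ _,
      fun σ hσ => Finset.mem_insert_of_mem (Finset.mem_union_left _ (Multiset.mem_toFinset.2 hσ)),
      fun σ hσ => Finset.mem_insert_of_mem (Finset.mem_union_right _ (Multiset.mem_toFinset.2 hσ))⟩
  refine ⟨S, hS, fun A B => ?_⟩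
  obtain ⟨ρ, hρ, hmin⟩ := Finset.exists_min_image S (fun σ => ‖B - σ‖) hS
  obtain ⟨A', hAA', hA'⟩ : ∃ A' : Kˣ, ‖(A : K)‖ ≤ ‖(A' : K)‖ ∧
      ∀ σ ∈ S, max ‖(A' : K)‖ ‖ρ - σ‖ = max ‖(A : K)‖ ‖B - σ‖ := by
    have h1 : ∀ σ, ‖ρ - σ‖ ≤ max ‖B - ρ‖ ‖B - σ‖ := fun σ => by
      simpa [norm_sub_rev ρ B] using IsUltrametricDist.norm_add_le_max (ρ - B) (B - σ)
    have h2 : ∀ σ, ‖B - σ‖ ≤ max ‖B - ρ‖ ‖ρ - σ‖ := fun σ => by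
      simpa using IsUltrametricDist.norm_add_le_max (B - ρ) (ρ - σ)
    rcases le_or_gt ‖B - ρ‖ ‖(A : K)‖ with h | h
    · refine ⟨A, le_rfl, fun σ _ => le_antisymm ?_ ?_⟩
      · exact max_le (le_max_left _ _) ((h1 σ).trans (max_le_max_right _ h))
      · exact max_le (le_max_left _ _) ((h2 σ).trans (max_le_max_right _ h))
    · have h0 : B - ρ ≠ 0 := norm_pos_iff.1 ((norm_nonneg _).trans_lt h)
      refine ⟨Units.mk0 _ h0, h.le, fun σ hσ => ?_⟩
      have h3 : ‖B - ρ‖ ≤ ‖B - σ‖ := hmin σ hσ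
      rw [Units.val_mk0, max_eq_right (h.le.trans h3)]
      exact le_antisymm (max_le h3 ((h1 σ).trans (max_le h3 le_rfl))) (h2 σ)
  refine ⟨A', ρ, hρ, ?_⟩
  have hpos : 0 < ‖(A : K)‖ := norm_pos_iff.2 A.ne_zero
  have hg : gaussComp (dehomOne G) (A' : K) ρ = gaussComp (dehomOne G) (A : K) B :=
    gaussComp_congr fun σ hσ => hA' σ (hSg σ hσ)
  have hf : gaussComp p (A' : K) ρ = gaussComp p (A : K) B :=
    gaussComp_congr fun σ hσ => hA' σ (hSp σ hσ)
  have hp0 : 0 ≤ gaussComp p (A : K) B := Polynomial.gaussNorm_nonneg _ _ zero_le_one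
  have hle : maxNorm K d (conjForms (affGL A' ρ) F G).1 (conjForms (affGL A' ρ) F G).2 ≤
      maxNorm K d (conjForms (affGL A B) F G).1 (conjForms (affGL A B) F G).2 := by
    rw [maxNorm_conjForms_affGL hF hG, maxNorm_conjForms_affGL hF hG, ← hp, hg, hf]
    gcongr
  unfold normRatio
  rw [det_affGL, det_affGL, norm_neg, norm_neg]
  have := maxNorm_nonneg (K := K) (e := d) (F := (conjForms (affGL A' ρ) F G).1) (G := (conjForms (affGL A' ρ) F G).2)
  gcongr

/-- The minimal resultant is attained. -/
lemma exists_normRatio_minimizer [IsAlgClosed K] (hd : 2 ≤ d) (hF : F.IsHomogeneous d)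
    (hG : G.IsHomogeneous d) (h : NoCommonZero F G) :
    ∃ M : GL (Fin 2) K, ∀ N : GL (Fin 2) K, normRatio d M F G ≤ normRatio d N F G := by
  obtain ⟨S, hS, hSle⟩ := exists_normRatio_affGL_le hF hG
  choose A hA using exists_affGL_minimizer hd hF hG h
  obtain ⟨ρ, -, hρ⟩ := Finset.exists_min_image S (fun B => normRatio d (affGL (A B) B) F G) hS
  refine ⟨affGL (A ρ) ρ, fun N => ?_⟩
  obtain ⟨A₁, B₁, hN⟩ := exists_normRatio_eq_affGL (by omega) hF hG N
  obtain ⟨A₂, σ, hσ, hle⟩ := hSle A₁ B₁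
  rw [hN]
  exact (hρ σ hσ).trans ((hA σ A₂).trans hle)

end Minimizer

section Degeneration

variable {k : Type*} [Field k] {d : ℕ} {F G : MvPolynomial (Fin 2) k}

/-- The pair `(F, G)` is a constant multiple of a form vanishing at that constant. -/
def InIndeterminacy (d : ℕ) (F G : MvPolynomial (Fin 2) k) : Prop :=
  ∃ (a b : k) (H : MvPolynomial (Fin 2) k), ¬(a = 0 ∧ b = 0) ∧ H.IsHomogeneous d ∧
    F = C a * H ∧ G = C b * H ∧ eval ![a, b] H = 0

/-- The forms `F` and `G` are linearly dependent. -/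
def Proportional (F G : MvPolynomial (Fin 2) k) : Prop :=
  ∃ a b : k, ¬(a = 0 ∧ b = 0) ∧ C a * F + C b * G = 0

lemma comp2_C_C (H : MvPolynomial (Fin 2) k) (a b : k) :
    comp2 H (C a) (C b) = C (eval ![a, b] H) := by
  unfold comp2
  induction H using MvPolynomial.induction_on with
  | C c => simp
  | add p q hp hq => simp only [map_add, hp, hq]
  | mul_X p i hp =>
    rw [map_mul, map_mul, hp, aeval_X, eval_X, C_mul]
    fin_cases i <;> simp

lemma comp2_C_mul_C_mul {H : MvPolynomial (Fin 2) k} {n : ℕ} (hH : H.IsHomogeneous n) (a b : k)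
    (f : MvPolynomial (Fin 2) k) :
    comp2 H (C a * f) (C b * f) = C (eval ![a, b] H) * f ^ n := by
  rw [mul_comm (C a), mul_comm (C b), comp2_mul_mul hH, comp2_C_C, mul_comm]

lemma comp2_X (H : MvPolynomial (Fin 2) k) : comp2 H (X 0) (X 1) = H := by
  have : (![X 0, X 1] : Fin 2 → MvPolynomial (Fin 2) k) = X := by
    ext1 i; fin_cases i <;> rfl
  rw [comp2, this, aeval_X_left_apply]

lemma InIndeterminacy.pairIter_two (h : InIndeterminacy d F G) :
    (pairIter F G 2).1 = 0 ∧ (pairIter F G 2).2 = 0 := by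
  obtain ⟨a, b, H, -, hH, rfl, rfl, h0⟩ := h
  have hc : ∀ c : k, comp2 (C c * H) (C a * H) (C b * H) = 0 := fun c => by
    rw [comp2, map_mul, ← comp2, ← comp2, comp2_C_mul_C_mul hH, h0, C_0, zero_mul, mul_zero]
  simp only [pairIter, comp2_X, hc, and_self]

lemma not_proportional_X : ¬Proportional (X 0 : MvPolynomial (Fin 2) k) (X 1) := by
  rintro ⟨a, b, hab, h⟩
  have h1 := congrArg (eval ![1, 0]) h
  have h2 := congrArg (eval ![0, 1]) h
  exact hab ⟨by simpa using h1, by simpa using h2⟩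

lemma exists_eq_C_mul_of_proportional (h : Proportional F G) :
    ∃ (a b : k) (H : MvPolynomial (Fin 2) k), ¬(a = 0 ∧ b = 0) ∧ F = C a * H ∧ G = C b * H ∧
      ∃ c : k, H = C c * F ∨ H = C c * G := by
  obtain ⟨a, b, hab, h⟩ := h
  by_cases ha : a = 0
  · have hb : b ≠ 0 := fun hb => hab ⟨ha, hb⟩
    subst ha
    have hG : G = 0 := by simpa [hb] using h
    exact ⟨1, 0, F, by simp, by simp, by simp [hG], 1, Or.inl (by simp)⟩
  · have hc : (C a : MvPolynomial (Fin 2) k) * C a⁻¹ = 1 := by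
      rw [← C_mul, mul_inv_cancel₀ ha, C_1]
    refine ⟨b, -a, C (-a⁻¹) * G, fun h => ha (neg_eq_zero.1 h.2), ?_, ?_, _, Or.inr rfl⟩
    · simp only [map_neg]
      linear_combination C a⁻¹ * h - F * hc
    · simp only [map_neg]
      linear_combination -G * hc

variable [IsAlgClosed k]

lemma proportional_of_comp2_eq_zero {H : MvPolynomial (Fin 2) k} {n : ℕ} (hH : H.IsHomogeneous n)
    (h0 : H ≠ 0) (h : comp2 H F G = 0) : Proportional F G := by
  revert h0 h
  refine binaryForm_induction (P := fun _ H => H ≠ 0 → comp2 H F G = 0 → Proportional F G)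
    (fun c hc h => ?_) (fun a b n H hab _ ih hne h => ?_) hH
  · simp only [comp2, algHom_C] at h
    exact absurd h hc
  · rw [comp2, map_mul, ← comp2, ← comp2] at h
    rcases mul_eq_zero.1 h with h | h
    · refine ⟨b, -a, fun h => hab ⟨neg_eq_zero.1 h.2, h.1⟩, ?_⟩
      rw [← h]
      simp [comp2, linForm, sub_eq_add_neg]
    · exact ih (right_ne_zero_of_mul hne) h

lemma not_proportional_pairIter (hF : F.IsHomogeneous d) (hG : G.IsHomogeneous d)
    (h : ¬Proportional F G) (n : ℕ) : ¬Proportional (pairIter F G n).1 (pairIter F G n).2 := by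
  induction n with
  | zero => exact not_proportional_X
  | succ n ih =>
    rintro ⟨a, b, hab, h0⟩
    refine ih (proportional_of_comp2_eq_zero ((hF.C_mul a).add (hG.C_mul b))
      (fun h1 => h ⟨a, b, hab, h1⟩) ?_)
    rw [← h0]
    simp [comp2, pairIter]

lemma not_inIndeterminacy_iff (hF : F.IsHomogeneous d) (hG : G.IsHomogeneous d) :
    ¬InIndeterminacy d F G ↔
      ∀ n, 1 ≤ n → ¬((pairIter F G n).1 = 0 ∧ (pairIter F G n).2 = 0) := by
  refine ⟨fun h n hn => ?_, fun h hI => h 2 one_le_two hI.pairIter_two⟩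
  by_cases hp : Proportional F G
  · obtain ⟨a, b, H, hab, rfl, rfl, c, hc⟩ := exists_eq_C_mul_of_proportional hp
    have hH : H.IsHomogeneous d := by
      rcases hc with hc | hc
      · exact hc ▸ hF.C_mul c
      · exact hc ▸ hG.C_mul c
    have h0 : eval ![a, b] H ≠ 0 := fun h0 => h ⟨a, b, H, hab, hH, rfl, rfl, h0⟩
    have key : ∀ n, ∃ Q ≠ 0, pairIter (C a * H) (C b * H) (n + 1) = (C a * Q, C b * Q) := by
      intro n
      induction n with
      | zero =>
        refine ⟨H, ?_, by simp [pairIter, comp2_X]⟩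
        rintro rfl
        exact h0 (map_zero _)
      | succ n ih =>
        obtain ⟨Q, hQ, h1⟩ := ih
        have h2 : ∀ c : k, comp2 (C c * H) (C a * Q) (C b * Q) =
            C c * (C (eval ![a, b] H) * Q ^ d) := fun c => by
          rw [← comp2_C_mul_C_mul hH]
          simp [comp2]
        refine ⟨C (eval ![a, b] H) * Q ^ d, mul_ne_zero (C_ne_zero.2 h0) (pow_ne_zero _ hQ), ?_⟩
        rw [pairIter, h1, h2, h2]
    obtain ⟨m, rfl⟩ := Nat.exists_eq_add_of_le' hn
    obtain ⟨Q, hQ, h1⟩ := key m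
    rw [h1]
    exact fun h2 => hab ⟨by simpa [hQ] using h2.1, by simpa [hQ] using h2.2⟩
  · rintro ⟨h1, h2⟩
    exact not_proportional_pairIter hF hG hp n ⟨1, 0, by simp, by simp [h1, h2]⟩

end Degeneration

section Reduction

variable {K : Type} [NontriviallyNormedField K] [IsUltrametricDist K] {d : ℕ}
  {F G : MvPolynomial (Fin 2) K}

lemma maxNorm_intMap_eq_one_iff {f g : MvPolynomial (Fin 2) (intRing K)} (hf : f.IsHomogeneous d)
    (hg : g.IsHomogeneous d) : maxNorm K d (intMap K f) (intMap K g) = 1 ↔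
      ¬(MvPolynomial.map (resMap K) f = 0 ∧ MvPolynomial.map (resMap K) g = 0) := by
  have hz : ∀ h : MvPolynomial (Fin 2) (intRing K), MvPolynomial.map (resMap K) h = 0 ↔
      ∀ m, ‖((coeff m h : intRing K) : K)‖ ≠ 1 := by
    intro h
    rw [MvPolynomial.ext_iff]
    refine forall_congr' fun m => ?_
    rw [MvPolynomial.coeff_map, coeff_zero, ← not_iff_not, not_not]
    exact resMap_ne_zero_iff
  rw [← normalized_iff (intMap_isHomogeneous_iff.2 hf) (intMap_isHomogeneous_iff.2 hg), hz, hz,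
    Normalized]
  simp only [coeff_intMap]
  have h1 : ∀ x : intRing K, ‖(x : K)‖ ≤ 1 := fun x => x.2
  constructor
  · rintro ⟨-, -, m, h | h⟩ h2
    exacts [h2.1 m h, h2.2 m h]
  · intro h
    refine ⟨fun m => h1 _, fun m => h1 _, ?_⟩
    by_contra! hcon
    exact h ⟨fun m => (hcon m).1, fun m => (hcon m).2⟩

lemma maxNorm_pairIter_le_one (hn : Normalized K F G) (n : ℕ) :
    maxNorm K (d ^ n) (pairIter F G n).1 (pairIter F G n).2 ≤ 1 := by
  obtain ⟨f, rfl⟩ := exists_intMap_eq hn.1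
  obtain ⟨g, rfl⟩ := exists_intMap_eq hn.2.1
  rw [map_pairIter]
  have h1 : ∀ x : intRing K, ‖(x : K)‖ ≤ 1 := fun x => x.2
  exact maxNorm_le (fun m => by rw [coeff_intMap]; exact h1 _)
    (fun m => by rw [coeff_intMap]; exact h1 _)

/-- The reduction of a normalized pair avoids the indeterminacy locus iff all its iterates are
normalized. -/
lemma not_Ilocus_iff [IsAlgClosed K] (hF : F.IsHomogeneous d) (hG : G.IsHomogeneous d)
    (hn : Normalized K F G) : ¬Ilocus K d F G ↔
      ∀ n, 1 ≤ n → maxNorm K (d ^ n) (pairIter F G n).1 (pairIter F G n).2 = 1 := by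
  obtain ⟨f, rfl⟩ := exists_intMap_eq hn.1
  obtain ⟨g, rfl⟩ := exists_intMap_eq hn.2.1
  have hf := intMap_isHomogeneous_iff.1 hF
  have hg := intMap_isHomogeneous_iff.1 hG
  have h1 : Ilocus K d (intMap K f) (intMap K g) ↔
      InIndeterminacy d (MvPolynomial.map (resMap K) f) (MvPolynomial.map (resMap K) g) := by
    rw [← redPoly_intMap, ← redPoly_intMap]
    exact Iff.rfl
  rw [h1, not_inIndeterminacy_iff (hf.map _) (hg.map _)]
  refine forall₂_congr fun n _ => ?_
  obtain ⟨h2, h3⟩ := pairIter_isHomogeneous hf hg n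
  rw [map_pairIter, map_pairIter, maxNorm_intMap_eq_one_iff h2 h3]

end Reduction

section Scaling

variable {S : Type*} [CommRing S] {F G : MvPolynomial (Fin 2) S} {d : ℕ}

lemma bres_smul (c : S) : bres d (c • F) (c • G) = c ^ (2 * d) * bres d F G := by
  have h : sylv d (coeffVec d (c • F)) (coeffVec d (c • G)) =
      c • sylv d (coeffVec d F) (coeffVec d G) := by
    ext i j
    simp only [sylv, coeffVec, Matrix.of_apply, Matrix.smul_apply, smul_dite, coeff_smul, smul_zero]
  rw [bres, bres, h, Matrix.det_smul, Fintype.card_fin, two_mul]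

lemma exists_pairIter_smul (hF : F.IsHomogeneous d) (hG : G.IsHomogeneous d) (c : S) (n : ℕ) :
    ∃ m : ℕ, pairIter (c • F) (c • G) n =
      (c ^ m • (pairIter F G n).1, c ^ m • (pairIter F G n).2) := by
  induction n with
  | zero => exact ⟨0, by simp [pairIter]⟩
  | succ n ih =>
    obtain ⟨m, hm⟩ := ih
    have h : ∀ {H : MvPolynomial (Fin 2) S}, H.IsHomogeneous d →
        comp2 (c • H) (c ^ m • (pairIter F G n).1) (c ^ m • (pairIter F G n).2) =
          c ^ (1 + m * d) • comp2 H (pairIter F G n).1 (pairIter F G n).2 := by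
      intro H hH
      have h1 : ∀ f g, comp2 (c • H) f g = c • comp2 H f g := fun f g => by simp [comp2]
      rw [h1, smul_eq_C_mul _ (c ^ m), smul_eq_C_mul _ (c ^ m), comp2_mul_mul hH, ← C_pow,
        ← smul_eq_C_mul, smul_smul]
      congr 1
      ring
    exact ⟨1 + m * d, by rw [pairIter, hm, h hF, h hG, pairIter]⟩

end Scaling

section Resultant

variable {K : Type} [NontriviallyNormedField K] {d : ℕ} {F G : MvPolynomial (Fin 2) K}

lemma Rpair_smul [IsAlgClosed K] (hd : 1 ≤ d) (hF : F.IsHomogeneous d) (hG : G.IsHomogeneous d)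
    (h : NoCommonZero F G) {c : K} (hc : c ≠ 0) :
    Rpair K d (c • F) (c • G) = Rpair K d F G := by
  have h1 : ‖c‖ ≠ 0 := norm_ne_zero_iff.2 hc
  have h2 : ‖bres d F G‖ ≠ 0 := norm_ne_zero_iff.2 (bres_ne_zero hd hF hG h)
  have h3 := (maxNorm_pos hF hG h.not_both_zero).ne'
  rw [Rpair, Rpair, ordv, ordv, bres_smul, maxNorm_smul, norm_mul, norm_pow,
    Real.log_mul (pow_ne_zero _ h1) h2, Real.log_mul h1 h3, Real.log_pow]
  push_cast
  ring

lemma Rpair_conjForms [IsAlgClosed K] (hd : 1 ≤ d) (hF : F.IsHomogeneous d)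
    (hG : G.IsHomogeneous d) (h : NoCommonZero F G) (M : GL (Fin 2) K) :
    Rpair K d (conjForms M F G).1 (conjForms M F G).2 =
      ordv K (bres d F G) + d * Real.log (normRatio d M F G) := by
  obtain ⟨h1, h2⟩ := conjForms_isHomogeneous M hF hG
  have hM := (norm_det_pos M).ne'
  have hb : ‖bres d F G‖ ≠ 0 := norm_ne_zero_iff.2 (bres_ne_zero hd hF hG h)
  have hm := (maxNorm_pos h1 h2 (h.conjForms M).not_both_zero).ne'
  have hdet : ‖M⁻¹.val.det‖ = ‖M.val.det‖⁻¹ := by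
    refine eq_inv_of_mul_eq_one_left ?_
    rw [← norm_mul, ← Matrix.det_mul, ← Units.val_mul, inv_mul_cancel, Units.val_one, det_one,
      norm_one]
  obtain ⟨e, rfl⟩ := Nat.exists_eq_add_of_le' hd
  rw [Rpair, ordv, ordv, bres_conjForms hF hG, normRatio, norm_mul, norm_mul, norm_pow, norm_pow,
    hdet, Real.log_mul (mul_ne_zero (pow_ne_zero _ (inv_ne_zero hM)) (pow_ne_zero _ hM)) hb,
    Real.log_mul (pow_ne_zero _ (inv_ne_zero hM)) (pow_ne_zero _ hM),
    Real.log_div (pow_ne_zero _ hm) (pow_ne_zero _ hM)]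
  simp only [Real.log_pow, Real.log_inv, Nat.add_sub_cancel]
  push_cast
  ring

lemma Rpair_pairIter [IsAlgClosed K] (hd : 2 ≤ d) (hF : F.IsHomogeneous d)
    (hG : G.IsHomogeneous d) (h : NoCommonZero F G) {c : Kˣ} (hc : Normalized K ((c : K) • F) ((c : K) • G)) (n : ℕ) :
    Rpair K (d ^ n) (pairIter F G n).1 (pairIter F G n).2 =
      (d : ℝ) ^ n * ((d : ℝ) ^ n - 1) / ((d : ℝ) * ((d : ℝ) - 1)) * Rpair K d F G +
        2 * (d : ℝ) ^ n * Real.log (maxNorm K (d ^ n) (pairIter ((c : K) • F) ((c : K) • G) n).1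
          (pairIter ((c : K) • F) ((c : K) • G) n).2) := by
  have h1 := isHomogeneous_smul hF (c : K)
  have h2 := isHomogeneous_smul hG (c : K)
  obtain ⟨h3, h4⟩ := pairIter_isHomogeneous hF hG n
  obtain ⟨m, hm⟩ := exists_pairIter_smul hF hG (c : K) n
  have h5 : Rpair K (d ^ n) (pairIter F G n).1 (pairIter F G n).2 =
      Rpair K (d ^ n) (pairIter ((c : K) • F) ((c : K) • G) n).1
        (pairIter ((c : K) • F) ((c : K) • G) n).2 := by
    rw [hm, Rpair_smul (Nat.one_le_pow _ _ (by omega)) h3 h4 (h.pairIter n)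
      (pow_ne_zero _ c.ne_zero)]
  rw [h5, ← Rpair_smul (by omega) hF hG h c.ne_zero, Rpair, Rpair, bres_pairIter h1 h2,
    (normalized_iff h1 h2).1 hc, Real.log_one, mul_zero, add_zero, ordv, ordv, norm_pow,
    Real.log_pow, iterExponent_eq hd]
  push_cast
  ring

variable [IsUltrametricDist K] [IsAlgClosed K]

lemma exists_Rmin_eq (hd : 2 ≤ d) (hF : F.IsHomogeneous d) (hG : G.IsHomogeneous d)
    (h : NoCommonZero F G) : ∃ M : GL (Fin 2) K,
      (∀ N, normRatio d M F G ≤ normRatio d N F G) ∧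
      Rmin K d F G = ordv K (bres d F G) + d * Real.log (normRatio d M F G) := by
  obtain ⟨M, hM⟩ := exists_normRatio_minimizer hd hF hG h
  refine ⟨M, hM, ?_⟩
  have hR : ∀ N : GL (Fin 2) K, Rpair K d (conjPair K N F G).1 (conjPair K N F G).2 =
      ordv K (bres d F G) + d * Real.log (normRatio d N F G) :=
    Rpair_conjForms (by omega) hF hG h
  have hmin : IsLeast (Set.range fun N : GL (Fin 2) K =>
      ordv K (bres d F G) + d * Real.log (normRatio d N F G))
      (ordv K (bres d F G) + d * Real.log (normRatio d M F G)) := by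
    refine ⟨⟨M, rfl⟩, ?_⟩
    rintro _ ⟨N, rfl⟩
    have h1 := normRatio_pos M hF hG h.not_both_zero
    have h2 := hM N
    dsimp only
    gcongr
  rw [Rmin]
  simp only [hR]
  exact hmin.csInf_eq

lemma Rmin_le (hd : 2 ≤ d) (hF : F.IsHomogeneous d) (hG : G.IsHomogeneous d)
    (h : NoCommonZero F G) (M : GL (Fin 2) K) :
    Rmin K d F G ≤ Rpair K d (conjForms M F G).1 (conjForms M F G).2 := by
  obtain ⟨M₀, h1, h2⟩ := exists_Rmin_eq hd hF hG h
  have h3 := normRatio_pos M₀ hF hG h.not_both_zero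
  have h4 := h1 M
  rw [h2, Rpair_conjForms (by omega) hF hG h]
  gcongr

lemma hasSemistableRed_iff (hd : 1 ≤ d) (hF : F.IsHomogeneous d) (hG : G.IsHomogeneous d)
    (h : ¬(F = 0 ∧ G = 0)) :
    HasSemistableRed K d F G ↔ ∀ N, normRatio d 1 F G ≤ normRatio d N F G := by
  have h1 : normRatio d 1 F G = maxNorm K d F G ^ 2 := by simp [normRatio, conjForms_one]
  have key : ∀ c : Kˣ, Normalized K ((c : K) • F) ((c : K) • G) →
      (Semistable K d ((c : K) • F) ((c : K) • G) ↔
        ∀ N, normRatio d 1 F G ≤ normRatio d N F G) := by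
    intro c hc
    have h2 := isHomogeneous_smul hF (c : K)
    have h3 := isHomogeneous_smul hG (c : K)
    rw [semistable_iff_forall_one_le_normRatio hd h2 h3 hc]
    rw [normalized_iff h2 h3, maxNorm_smul] at hc
    refine forall_congr' fun N => ?_
    have hpos : 0 < ‖(c : K)‖ ^ 2 := pow_pos (norm_pos_iff.2 c.ne_zero) 2
    rw [normRatio_smul, ← one_pow 2, ← hc, mul_pow, ← h1, mul_le_mul_iff_right₀ hpos]
  constructor
  · rintro ⟨c, hc, hs⟩
    exact (key c hc).1 hs
  · intro hN
    obtain ⟨c, hc⟩ := exists_normalizing_scalar hF hG h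
    exact ⟨c, hc, (key c hc).2 hN⟩

lemma hasSemistableRed_conjForms_iff (hd : 1 ≤ d) (hF : F.IsHomogeneous d)
    (hG : G.IsHomogeneous d) (h : NoCommonZero F G) (M : GL (Fin 2) K) :
    HasSemistableRed K d (conjForms M F G).1 (conjForms M F G).2 ↔
      ∀ N, normRatio d M F G ≤ normRatio d N F G := by
  obtain ⟨h1, h2⟩ := conjForms_isHomogeneous M hF hG
  rw [hasSemistableRed_iff hd h1 h2 (h.conjForms M).not_both_zero]
  have hpos : 0 < ‖M.val.det‖ ^ (d - 1) := pow_pos (norm_det_pos M) _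
  have h3 : ∀ N, normRatio d 1 (conjForms M F G).1 (conjForms M F G).2 ≤
      normRatio d N (conjForms M F G).1 (conjForms M F G).2 ↔
        normRatio d M F G ≤ normRatio d (M * N) F G := fun N => by
    conv_rhs => rw [← mul_one M, mul_assoc, one_mul]
    rw [normRatio_mul, normRatio_mul, div_le_div_iff_of_pos_right hpos]
  simp only [h3]
  exact ((Group.mulLeft_bijective M).surjective.forall (p := fun N =>
    normRatio d M F G ≤ normRatio d N F G)).symm

/-- Semistable reduction means that the minimal resultant is attained. -/
lemma hasSemistableRed_conjForms_iff_Rpair_eq_Rmin (hd : 2 ≤ d) (hF : F.IsHomogeneous d)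
    (hG : G.IsHomogeneous d) (h : NoCommonZero F G) (M : GL (Fin 2) K) :
    HasSemistableRed K d (conjForms M F G).1 (conjForms M F G).2 ↔
      Rpair K d (conjForms M F G).1 (conjForms M F G).2 = Rmin K d F G := by
  obtain ⟨M₀, h1, h2⟩ := exists_Rmin_eq hd hF hG h
  have hpos := fun N => normRatio_pos N hF hG h.not_both_zero
  rw [hasSemistableRed_conjForms_iff (by omega) hF hG h, h2, Rpair_conjForms (by omega) hF hG h]
  constructor
  · intro hM
    rw [le_antisymm (hM M₀) (h1 M)]
  · intro hM N
    have hd0 : (d : ℝ) ≠ 0 := by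
      rw [Nat.cast_ne_zero]
      omega
    have := Real.log_injOn_pos (hpos M) (hpos M₀) (mul_left_cancel₀ hd0 (add_left_cancel hM))
    exact this.trans_le (h1 N)

end Resultant

/-- **Main Theorem.** For `φ` of degree `d ≥ 2`, the minimal resultant iteration
formula `R_{[φⁿ]} = N_n · R_{[φ]}` holds for all `n ≥ 1` iff for every `γ ∈ PGL₂(K)` such that
`φ^γ` has semistable reduction, one has `(φ^γ)_v ∉ I(d)` and `(φ^γ)ⁿ` has semistable reduction
for all `n ≥ 1`. -/
theorem minimal_resultant_iteration_main {K : Type} [NontriviallyNormedField K]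
    [IsAlgClosed K] [CompleteSpace K] [IsUltrametricDist K] (d : ℕ) (hd : 2 ≤ d)
    (F G : MvPolynomial (Fin 2) K) (hlift : LiftPair K d F G) (hnorm : Normalized K F G) :
    (∀ n : ℕ, 1 ≤ n →
        Rmin K (d ^ n) (pairIter F G n).1 (pairIter F G n).2 =
          ((d : ℝ) ^ n * ((d : ℝ) ^ n - 1) / ((d : ℝ) * ((d : ℝ) - 1))) * Rmin K d F G)
    ↔
    (∀ M : GL (Fin 2) K,
        HasSemistableRed K d (conjPair K M F G).1 (conjPair K M F G).2 →
          RedOutsideI K d (conjPair K M F G).1 (conjPair K M F G).2 ∧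
          ∀ n : ℕ, 1 ≤ n →
            HasSemistableRed K (d ^ n)
              (pairIter (conjPair K M F G).1 (conjPair K M F G).2 n).1
              (pairIter (conjPair K M F G).1 (conjPair K M F G).2 n).2) := by
  obtain ⟨hF, hG, hrel⟩ := hlift
  have h : NoCommonZero F G := hrel.noCommonZero hF hG
  have hdeg : ∀ n, 1 ≤ n → 2 ≤ d ^ n := fun n hn => hd.trans (Nat.le_self_pow (by omega) d)
  have hI := pairIter_isHomogeneous hF hG
  have hC := fun M => conjForms_isHomogeneous M hF hG
  change _ ↔ ∀ M : GL (Fin 2) K, HasSemistableRed K d (conjForms M F G).1 (conjForms M F G).2 →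
    RedOutsideI K d (conjForms M F G).1 (conjForms M F G).2 ∧ ∀ n : ℕ, 1 ≤ n →
      HasSemistableRed K (d ^ n) (pairIter (conjForms M F G).1 (conjForms M F G).2 n).1
        (pairIter (conjForms M F G).1 (conjForms M F G).2 n).2
  constructor
  · intro hR M hM
    rw [hasSemistableRed_conjForms_iff_Rpair_eq_Rmin hd hF hG h] at hM
    obtain ⟨h1, h2⟩ := hC M
    have hNC := h.conjForms M
    obtain ⟨c, hc⟩ := exists_normalizing_scalar h1 h2 hNC.not_both_zero
    have h3 := isHomogeneous_smul h1 (c : K)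
    have h4 := isHomogeneous_smul h2 (c : K)
    have key : ∀ n, 1 ≤ n →
        Rpair K (d ^ n) (pairIter (conjForms M F G).1 (conjForms M F G).2 n).1
          (pairIter (conjForms M F G).1 (conjForms M F G).2 n).2 =
            Rmin K (d ^ n) (pairIter F G n).1 (pairIter F G n).2 ∧
        maxNorm K (d ^ n)
          (pairIter ((c : K) • (conjForms M F G).1) ((c : K) • (conjForms M F G).2) n).1
          (pairIter ((c : K) • (conjForms M F G).1) ((c : K) • (conjForms M F G).2) n).2 = 1 := by
      intro n hn
      obtain ⟨h5, h6⟩ := pairIter_isHomogeneous h3 h4 n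
      have hle := Rmin_le (hdeg n hn) (hI n).1 (hI n).2 (h.pairIter n) M
      have heq := Rpair_pairIter hd h1 h2 hNC hc n
      obtain ⟨m, hm⟩ := exists_pairIter_smul h1 h2 (c : K) n
      have hpos : 0 < maxNorm K (d ^ n)
          (pairIter ((c : K) • (conjForms M F G).1) ((c : K) • (conjForms M F G).2) n).1
          (pairIter ((c : K) • (conjForms M F G).1) ((c : K) • (conjForms M F G).2) n).2 := by
        refine maxNorm_pos h5 h6 ?_
        rw [hm]
        simpa using (hNC.pairIter n).not_both_zero
      have hle1 := maxNorm_pairIter_le_one (d := d) hc n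
      have hlog := Real.log_nonpos hpos.le hle1
      have hdn : (0 : ℝ) < 2 * (d : ℝ) ^ n := by positivity
      rw [← pairIter_conjForms] at hle
      rw [hM, ← hR n hn] at heq
      have hlog0 := le_antisymm hlog (nonneg_of_mul_nonneg_right (by linarith) hdn)
      rw [hlog0, mul_zero, add_zero] at heq
      exact ⟨heq, Real.eq_one_of_pos_of_log_eq_zero hpos hlog0⟩
    refine ⟨⟨c, hc, (not_Ilocus_iff h3 h4 hc).2 fun n hn => (key n hn).2⟩, fun n hn => ?_⟩
    have := (key n hn).1
    rw [pairIter_conjForms] at this ⊢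
    exact (hasSemistableRed_conjForms_iff_Rpair_eq_Rmin (hdeg n hn) (hI n).1 (hI n).2
      (h.pairIter n) M).2 this
  · intro hS n hn
    obtain ⟨M, hM⟩ := exists_normRatio_minimizer hd hF hG h
    have hM := (hasSemistableRed_conjForms_iff (by omega) hF hG h M).2 hM
    obtain ⟨⟨c, hc, hI'⟩, hit⟩ := hS M hM
    obtain ⟨h1, h2⟩ := hC M
    have hnorm := (not_Ilocus_iff (isHomogeneous_smul h1 (c : K)) (isHomogeneous_smul h2 (c : K))
      hc).1 hI' n hn
    have heq := Rpair_pairIter hd h1 h2 (h.conjForms M) hc n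
    rw [hnorm, Real.log_one, mul_zero, add_zero,
      (hasSemistableRed_conjForms_iff_Rpair_eq_Rmin hd hF hG h M).1 hM] at heq
    have hit := hit n hn
    rw [pairIter_conjForms] at hit heq
    rw [← heq, (hasSemistableRed_conjForms_iff_Rpair_eq_Rmin (hdeg n hn) (hI n).1 (hI n).2
      (h.pairIter n) M).1 hit]

end
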